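/- arXiv:0911.2627 — 3 statements merged into one kernel-verified Lean document; each statement's English description precedes it below -/
import Mathlib

section
/- Let f(x,y) ∈ ℝ[x,y] be a non-degenerate polynomial of total degree k ≥ 2. Then there exists a constant c > 0 depending only on k such that for every finite set A ⊆ ℝ one has |A+A| · |f(A,A)| ≥ c·|A|^{5/2}, where A+A = {a+b : a,b ∈ A} and f(A,A) = {f(a,b) : a,b ∈ A}. -/
open Finset Pointwise

/-- A polynomial `f(x,y) ∈ ℝ[x,y]` is degenerate if it can be written as
`Q(L(x,y))` where `Q` is a one-variable real polynomial and `L` is a linear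
form in `x` and `y`. -/
def IsDegenerate (f : MvPolynomial (Fin 2) ℝ) : Prop :=
  ∃ (Q : Polynomial ℝ) (a b : ℝ), ∀ x y : ℝ,
    MvPolynomial.eval ![x, y] f = Q.eval (a * x + b * y)

/-- `g : ℝ → ℝ` is given by a polynomial of degree at most `n`. -/
def IsPolyFun (n : ℕ) (g : ℝ → ℝ) : Prop :=
  ∃ p : Polynomial ℝ, p.natDegree ≤ n ∧ ∀ x, g x = p.eval x

namespace IsPolyFun

variable {m n : ℕ} {g h : ℝ → ℝ}

lemma mono (hg : IsPolyFun m g) (hmn : m ≤ n) : IsPolyFun n g := by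
  obtain ⟨p, hp, hpg⟩ := hg
  exact ⟨p, hp.trans hmn, hpg⟩

lemma const (n : ℕ) (c : ℝ) : IsPolyFun n (fun _ => c) :=
  ⟨Polynomial.C c, by simp, by simp⟩

lemma id : IsPolyFun 1 (fun x => x) :=
  ⟨Polynomial.X, by simp, by simp⟩

lemma sub (hg : IsPolyFun n g) (hh : IsPolyFun n h) : IsPolyFun n (fun x => g x - h x) := by
  obtain ⟨p, hp, hpg⟩ := hg
  obtain ⟨q, hq, hqh⟩ := hh
  exact ⟨p - q, (Polynomial.natDegree_sub_le _ _).trans (max_le hp hq), by simp [hpg, hqh]⟩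

lemma mul (hg : IsPolyFun m g) (hh : IsPolyFun n h) :
    IsPolyFun (m + n) (fun x => g x * h x) := by
  obtain ⟨p, hp, hpg⟩ := hg
  obtain ⟨q, hq, hqh⟩ := hh
  exact ⟨p * q, Polynomial.natDegree_mul_le.trans (add_le_add hp hq), by simp [hpg, hqh]⟩

lemma pow (hg : IsPolyFun n g) (i : ℕ) : IsPolyFun (i * n) (fun x => g x ^ i) := by
  obtain ⟨p, hp, hpg⟩ := hg
  exact ⟨p ^ i, Polynomial.natDegree_pow_le.trans (Nat.mul_le_mul_left i hp), by simp [hpg]⟩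

lemma sum {ι : Type*} (s : Finset ι) {G : ι → ℝ → ℝ} (hG : ∀ i ∈ s, IsPolyFun n (G i)) :
    IsPolyFun n (fun x => ∑ i ∈ s, G i x) := by
  choose! p hp hpG using hG
  refine ⟨∑ i ∈ s, p i, Polynomial.natDegree_sum_le_of_forall_le s p hp, fun x => ?_⟩
  rw [Polynomial.eval_finsetSum]
  exact Finset.sum_congr rfl fun i hi => hpG i hi x

lemma comp_add_const (hg : IsPolyFun n g) (c : ℝ) : IsPolyFun n (fun x => g (x + c)) := by
  obtain ⟨p, hp, hpg⟩ := hg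
  refine ⟨p.comp (Polynomial.X + Polynomial.C c), ?_, by simp [hpg]⟩
  rw [Polynomial.natDegree_comp, Polynomial.natDegree_X_add_C, mul_one]
  exact hp

lemma continuous (hg : IsPolyFun n g) : Continuous g := by
  obtain ⟨p, -, hpg⟩ := hg
  rw [funext hpg]
  exact p.continuous

lemma card_le_of_forall_eq_zero (hg : IsPolyFun n g) {x₀ : ℝ} (h₀ : g x₀ ≠ 0) {s : Finset ℝ}
    (hs : ∀ x ∈ s, g x = 0) : s.card ≤ n := by
  obtain ⟨p, hp, hpg⟩ := hg
  have hp0 : p ≠ 0 := by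
    rintro rfl
    exact h₀ (by simp [hpg])
  refine le_trans ?_ ((Polynomial.card_roots' p).trans hp)
  refine le_trans (Finset.card_le_card fun x hx => ?_) (Multiset.toFinset_card_le _)
  rw [Multiset.mem_toFinset, Polynomial.mem_roots hp0, Polynomial.IsRoot, ← hpg]
  exact hs x hx

lemma eq_zero_of_card_lt (hg : IsPolyFun n g) {s : Finset ℝ} (hs : ∀ x ∈ s, g x = 0)
    (hn : n < s.card) (x : ℝ) : g x = 0 := by
  by_contra h
  exact absurd (hg.card_le_of_forall_eq_zero h hs) (by omega)

lemma eq_zero_or_eq_zero (hg : IsPolyFun m g) (hh : IsPolyFun n h)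
    (hgh : ∀ x, g x * h x = 0) {x₀ : ℝ} (h₀ : g x₀ ≠ 0) (x : ℝ) : h x = 0 := by
  obtain ⟨p, -, hpg⟩ := hg
  obtain ⟨q, -, hqh⟩ := hh
  have hpq : p * q = 0 := Polynomial.funext fun x => by simp [← hpg, ← hqh, hgh]
  rcases mul_eq_zero.1 hpq with rfl | rfl
  · exact absurd (by simp [hpg]) h₀
  · simp [hqh]

end IsPolyFun

lemma isPolyFun_sum_pow {D : ℕ} (c : Fin (D + 1) → ℝ) :
    IsPolyFun D (fun z => ∑ i, c i * z ^ (i : ℕ)) := by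
  refine IsPolyFun.sum _ fun i _ => ?_
  refine ((IsPolyFun.const 0 (c i)).mul (IsPolyFun.id.pow i)).mono ?_
  omega

lemma exists_sum_pow_ne_zero {D : ℕ} {c : Fin (D + 1) → ℝ} {i₀ : Fin (D + 1)} (hc : c i₀ ≠ 0)
    {S : Set ℝ} (hS : S.Infinite) : ∃ z ∈ S, ∑ i, c i * z ^ (i : ℕ) ≠ 0 := by
  by_contra! h
  let p : Polynomial ℝ := ∑ i : Fin (D + 1), Polynomial.C (c i) * Polynomial.X ^ (i : ℕ)
  have hp : p = 0 := by
    refine Polynomial.eq_zero_of_infinite_isRoot p (hS.mono fun z hz => ?_)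
    simpa [p, Polynomial.eval_finsetSum] using h z hz
  have hcoeff : p.coeff i₀ = c i₀ := by
    simp only [p, Polynomial.finsetSum_coeff, Polynomial.coeff_C_mul, Polynomial.coeff_X_pow]
    rw [Finset.sum_eq_single i₀]
    · simp
    · intro j _ hj
      have : (i₀ : ℕ) ≠ j := fun h => hj (Fin.ext h.symm)
      simp [this]
    · simp
  rw [hp] at hcoeff
  exact hc (by simpa using hcoeff.symm)

lemma card_le_of_forall_sum_pow_eq_zero {D : ℕ} {c : Fin (D + 1) → ℝ} {i₀ : Fin (D + 1)}
    (hc : c i₀ ≠ 0) {s : Finset ℝ} (hs : ∀ z ∈ s, ∑ i, c i * z ^ (i : ℕ) = 0) : s.card ≤ D := by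
  obtain ⟨z, -, hz⟩ := exists_sum_pow_ne_zero hc Set.infinite_univ
  exact (isPolyFun_sum_pow c).card_le_of_forall_eq_zero hz hs

/-- `g : ℝ → ℝ → ℝ` is a polynomial function of degree at most `n` in each variable. -/
def IsPolyFun₂ (n : ℕ) (g : ℝ → ℝ → ℝ) : Prop :=
  (∀ y, IsPolyFun n fun x => g x y) ∧ ∀ x, IsPolyFun n fun y => g x y

/-- Three polynomial functions in two variables satisfy a polynomial relation of controlled
degree. -/
lemma exists_algebraic_relation {k : ℕ} (hk : 0 < k) {g₁ g₂ l : ℝ → ℝ → ℝ}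
    (h₁ : IsPolyFun₂ k g₁) (h₂ : IsPolyFun₂ k g₂) (hl : IsPolyFun₂ k l) :
    ∃ c : Fin ((3 * k) ^ 2 + 1) → Fin ((3 * k) ^ 2 + 1) → Fin ((3 * k) ^ 2 + 1) → ℝ, c ≠ 0 ∧
      ∀ x y, ∑ i, (∑ j, (∑ m, c i j m * g₂ x y ^ (m : ℕ)) * g₁ x y ^ (j : ℕ)) *
        l x y ^ (i : ℕ) = 0 := by
  set D := (3 * k) ^ 2 with hD
  let N := 3 * k * D
  let Φ : (Fin (D + 1) → Fin (D + 1) → Fin (D + 1) → ℝ) →ₗ[ℝ]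
      (Fin (N + 1) → Fin (N + 1) → ℝ) :=
    { toFun := fun c p q => ∑ i, (∑ j, (∑ m, c i j m * g₂ (p : ℕ) (q : ℕ) ^ (m : ℕ)) *
        g₁ (p : ℕ) (q : ℕ) ^ (j : ℕ)) * l (p : ℕ) (q : ℕ) ^ (i : ℕ)
      map_add' := fun c d => by
        ext p q
        simp only [Pi.add_apply, add_mul, Finset.sum_add_distrib]
      map_smul' := fun r c => by
        ext p q
        simp only [Pi.smul_apply, smul_eq_mul, RingHom.id_apply, Finset.mul_sum, mul_assoc,
          Finset.sum_mul] }
  have hrank : Module.finrank ℝ (Fin (N + 1) → Fin (N + 1) → ℝ) <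
      Module.finrank ℝ (Fin (D + 1) → Fin (D + 1) → Fin (D + 1) → ℝ) := by
    simp only [Module.finrank_pi_fintype, Module.finrank_self, Finset.sum_const, Finset.card_univ,
      Fintype.card_fin, smul_eq_mul, mul_one]
    have h1 : N + 1 ≤ 3 * k * (D + 1) := by simp only [N]; nlinarith
    calc (N + 1) * (N + 1) ≤ (3 * k * (D + 1)) * (3 * k * (D + 1)) := Nat.mul_le_mul h1 h1
      _ = D * ((D + 1) * (D + 1)) := by rw [hD]; ring
      _ < (D + 1) * ((D + 1) * (D + 1)) := by
        apply Nat.mul_lt_mul_of_pos_right (Nat.lt_succ_self D); positivity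
  obtain ⟨c, hcΦ, hc⟩ := (Submodule.ne_bot_iff _).1 (Φ.ker_ne_bot_of_finrank_lt hrank)
  refine ⟨c, hc, ?_⟩
  set Ψ : ℝ → ℝ → ℝ := fun x y => ∑ i, (∑ j, (∑ m, c i j m * g₂ x y ^ (m : ℕ)) *
    g₁ x y ^ (j : ℕ)) * l x y ^ (i : ℕ) with hΨ
  have hgrid : ∀ p q : Fin (N + 1), Ψ (p : ℕ) (q : ℕ) = 0 := fun p q =>
    congrFun (congrFun (LinearMap.mem_ker.1 hcΦ) p) q
  have hpoly : ∀ u v w : ℝ → ℝ, IsPolyFun k u → IsPolyFun k v → IsPolyFun k w →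
      IsPolyFun N (fun x => ∑ i : Fin (D + 1), (∑ j : Fin (D + 1), (∑ m : Fin (D + 1),
        c i j m * u x ^ (m : ℕ)) * v x ^ (j : ℕ)) * w x ^ (i : ℕ)) := by
    intro u v w hu hv hw
    have hpow : ∀ {r : ℝ → ℝ}, IsPolyFun k r → ∀ i : Fin (D + 1),
        IsPolyFun (D * k) (fun x => r x ^ (i : ℕ)) := fun hr i =>
      (hr.pow i).mono (Nat.mul_le_mul_right k (by omega))
    have hN : 0 + D * k + D * k + D * k = N := by simp only [N]; ring
    rw [← hN]
    refine IsPolyFun.sum _ fun i _ => IsPolyFun.mul ?_ (hpow hw i)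
    refine IsPolyFun.sum _ fun j _ => IsPolyFun.mul ?_ (hpow hv j)
    exact IsPolyFun.sum _ fun m _ => (IsPolyFun.const 0 _).mul (hpow hu m)
  let G : Finset ℝ := (Finset.range (N + 1)).image (fun p : ℕ => (p : ℝ))
  have hG : N < G.card := by
    rw [Finset.card_image_of_injective _ Nat.cast_injective, Finset.card_range]
    omega
  have hmem : ∀ z ∈ G, ∃ p : Fin (N + 1), z = (p : ℕ) := by
    intro z hz
    obtain ⟨p, hp, rfl⟩ := Finset.mem_image.1 hz
    exact ⟨⟨p, Finset.mem_range.1 hp⟩, rfl⟩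
  intro x y
  refine (hpoly _ _ _ (h₂.2 x) (h₁.2 x) (hl.2 x)).eq_zero_of_card_lt (s := G) ?_ hG y
  intro y' hy'
  refine (hpoly _ _ _ (h₂.1 y') (h₁.1 y') (hl.1 y')).eq_zero_of_card_lt (s := G) ?_ hG x
  intro x' hx'
  obtain ⟨p, rfl⟩ := hmem x' hx'
  obtain ⟨q, rfl⟩ := hmem y' hy'
  exact hgrid p q

/-- The derivative `(x, y) ↦ (a x + b y, c x + d y)` is onto when its determinant is nonzero. -/
lemma range_prod_smul_eq_top {a b c d : ℝ} (h : a * d - b * c ≠ 0) :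
    ((a • ContinuousLinearMap.fst ℝ ℝ ℝ + b • ContinuousLinearMap.snd ℝ ℝ ℝ).prod
      (c • ContinuousLinearMap.fst ℝ ℝ ℝ + d • ContinuousLinearMap.snd ℝ ℝ ℝ)).range = ⊤ := by
  refine LinearMap.range_eq_top.2 fun ⟨u, v⟩ => ?_
  refine ⟨((d * u - b * v) / (a * d - b * c), (a * v - c * u) / (a * d - b * c)), ?_⟩
  generalize hΔ : a * d - b * c = Δ at h
  ext <;> simp <;> field_simp <;> rw [← hΔ] <;> ring

/-- A polynomial takes boundedly many values on the nondegenerate solutions of a system of two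
polynomial equations in two variables. -/
lemma card_image_le_of_nondegenerate {k : ℕ} (hk : 0 < k) {g₁ g₂ l : ℝ → ℝ → ℝ}
    (h₁ : IsPolyFun₂ k g₁) (h₂ : IsPolyFun₂ k g₂) (hl : IsPolyFun₂ k l)
    (hlc : Continuous fun p : ℝ × ℝ => l p.1 p.2) {T : Finset (ℝ × ℝ)} {v : ℝ × ℝ}
    (hmap : ∀ p ∈ T, Filter.map (fun q : ℝ × ℝ => (g₁ q.1 q.2, g₂ q.1 q.2)) (nhds p) = nhds v) :
    (T.image fun p => l p.1 p.2).card ≤ (3 * k) ^ 2 := by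
  obtain ⟨c, hc, hrel⟩ := exists_algebraic_relation hk h₁ h₂ hl
  obtain ⟨i₀, j₀, m₀, hc₀⟩ : ∃ i₀ j₀ m₀, c i₀ j₀ m₀ ≠ 0 := by
    by_contra! h
    exact hc (by ext i j m; exact h i j m)
  set L := T.image fun p => l p.1 p.2 with hL
  obtain ⟨U, hU, hUd⟩ := L.finite_toSet.t2_separation
  have hW : (⋂ p ∈ T, (fun q : ℝ × ℝ => (g₁ q.1 q.2, g₂ q.1 q.2)) ''
      ((fun q : ℝ × ℝ => l q.1 q.2) ⁻¹' U (l p.1 p.2))) ∈ nhds v := by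
    refine (Filter.biInter_finset_mem T).2 fun p hp => ?_
    rw [← hmap p hp]
    exact Filter.image_mem_map (((hU _).2.preimage hlc).mem_nhds (hU _).1)
  rw [nhds_prod_eq (x := v.1) (y := v.2) |> fun h => (show nhds v = _ from h),
    Filter.mem_prod_iff] at hW
  obtain ⟨S₁, hS₁, S₂, hS₂, hS⟩ := hW
  obtain ⟨t, ht, htc⟩ := exists_sum_pow_ne_zero hc₀ (infinite_of_mem_nhds _ hS₂)
  obtain ⟨s, hs, hsc⟩ := exists_sum_pow_ne_zero
    (c := fun j => ∑ m, c i₀ j m * t ^ (m : ℕ)) htc (infinite_of_mem_nhds _ hS₁)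
  have hex : ∀ z ∈ L, ∃ q : ℝ × ℝ, l q.1 q.2 ∈ U z ∧ g₁ q.1 q.2 = s ∧ g₂ q.1 q.2 = t := by
    intro z hz
    obtain ⟨p, hp, rfl⟩ := Finset.mem_image.1 hz
    obtain ⟨q, hq, hqe⟩ := Set.mem_iInter₂.1 (hS (Set.mk_mem_prod hs ht)) p hp
    exact ⟨q, hq, congrArg Prod.fst hqe, congrArg Prod.snd hqe⟩
  choose! q hqU hq₁ hq₂ using hex
  have hinj : Set.InjOn (fun z => l (q z).1 (q z).2) L := by
    intro z hz w hw hzw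
    by_contra hne
    refine Set.disjoint_left.1 (hUd hz hw hne) (hqU z hz) ?_
    rw [show l (q z).1 (q z).2 = l (q w).1 (q w).2 from hzw]
    exact hqU w hw
  rw [← Finset.card_image_of_injOn hinj]
  refine card_le_of_forall_sum_pow_eq_zero
    (c := fun i => ∑ j, (∑ m, c i j m * t ^ (m : ℕ)) * s ^ (j : ℕ)) hsc fun z hz => ?_
  obtain ⟨w, hw, rfl⟩ := Finset.mem_image.1 hz
  have := hrel (q w).1 (q w).2
  rw [hq₁ w hw, hq₂ w hw] at this
  exact this

/-- A finite set of reals can be cut into blocks of at most `s` elements, the blocks being the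
fibres of a function whose jumps are located on a small finite set. -/
lemma exists_block_partition (B : Finset ℝ) {s : ℕ} (hs : 0 < s) :
    ∃ (Θ : Finset ℝ) (β : ℝ → ℕ), Θ.card ≤ B.card / s + 1 ∧
      (∀ u v, β u ≠ β v → ∃ θ ∈ Θ, θ ∈ Set.uIcc u v) ∧
      ((B ×ˢ B).filter fun p => β p.1 = β p.2).card ≤ B.card * s := by
  let r : ℝ → ℕ := fun u => (B.filter fun z => z < u).card
  have hr : Monotone r := fun u v huv => Finset.card_le_card fun z hz => by
    simp only [Finset.mem_filter] at hz ⊢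
    exact ⟨hz.1, hz.2.trans_le huv⟩
  have hrs : StrictMonoOn r B := fun u hu v _ huv => by
    refine Finset.card_lt_card (Finset.ssubset_iff_of_subset (fun z hz => ?_) |>.2 ⟨u, ?_, ?_⟩)
    · simp only [Finset.mem_filter] at hz ⊢
      exact ⟨hz.1, hz.2.trans huv⟩
    · simpa using ⟨hu, huv⟩
    · simp
  let β : ℝ → ℕ := fun u => r u / s
  have hβ : Monotone β := fun u v huv => Nat.div_le_div_right (hr huv)
  have hβB : ∀ u, β u ≤ B.card / s := fun u =>
    Nat.div_le_div_right (Finset.card_le_card (Finset.filter_subset _ _))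
  let τ : ℕ → ℝ := fun j => sInf {w | j ≤ β w}
  have hlt : ∀ u v, β u < β v → ∃ θ ∈ (Finset.range (B.card / s + 1)).image τ,
      θ ∈ Set.Icc u v := fun u v huv => by
    refine ⟨τ (β v), Finset.mem_image_of_mem τ (Finset.mem_range.2 (by have := hβB v; omega)), ?_⟩
    have hlb : ∀ w ∈ {w | β v ≤ β w}, u ≤ w := fun w hw => by
      by_contra! h
      exact absurd (hβ h.le) (by have : β v ≤ β w := hw; omega)
    exact ⟨le_csInf ⟨v, le_refl (β v)⟩ hlb, csInf_le ⟨u, hlb⟩ (le_refl (β v))⟩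
  refine ⟨(Finset.range (B.card / s + 1)).image τ, β, ?_, fun u v huv => ?_, ?_⟩
  · exact Finset.card_image_le.trans (by simp)
  · rcases lt_or_gt_of_ne huv with h | h
    · obtain ⟨θ, hθ, hθuv⟩ := hlt u v h
      exact ⟨θ, hθ, Set.Icc_subset_uIcc hθuv⟩
    · obtain ⟨θ, hθ, hθuv⟩ := hlt v u h
      exact ⟨θ, hθ, Set.Icc_subset_uIcc' hθuv⟩
  · rw [mul_comm]
    refine Finset.card_le_mul_card_image_of_maps_to (f := Prod.fst)
      (fun p hp => (Finset.mem_product.1 (Finset.mem_filter.1 hp).1).1) s fun u _ => ?_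
    have hI : (Finset.Ico (s * β u) (s * β u + s)).card = s := by simp
    refine le_of_le_of_eq ?_ hI
    refine Finset.card_le_card_of_injOn (fun p => r p.2) (fun p hp => ?_) fun p hp q hq hpq => ?_
    · simp only [Finset.coe_filter, Finset.mem_filter, Finset.mem_product, Set.mem_ofPred_eq] at hp
      have h2 : r p.2 / s = β u := by rw [← hp.2]; exact hp.1.2.symm
      have h3 := Nat.div_add_mod (r p.2) s
      have h4 := Nat.mod_lt (r p.2) hs
      rw [h2] at h3
      simp only [Finset.coe_Ico, Set.mem_Ico]
      omega
    · simp only [Finset.coe_filter, Finset.mem_filter, Finset.mem_product, Set.mem_ofPred_eq]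
        at hp hq
      exact Prod.ext (hp.2.trans hq.2.symm) (hrs.injOn hp.1.1.2 hq.1.1.2 hpq)

/-- Each element of a large subset of `A` has a close successor in `A` to which it is related by
`P`, if `P` fails only rarely. -/
lemma exists_successor (A : Finset ℝ) (P : ℝ → ℝ → Prop) {K : ℕ}
    (h₁ : ∀ S : Finset ℝ, (∀ x ∈ S, ∀ z, ¬ P x z) → S.card ≤ K)
    (h₂ : ∀ x, (∃ z, P x z) → ∀ S : Finset ℝ, (∀ z ∈ S, ¬ P x z) → S.card ≤ K) :
    ∃ A' ⊆ A, ∃ σ : ℝ → ℝ, A.card ≤ A'.card + (2 * K + 1) ∧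
      (∀ x ∈ A', σ x ∈ A ∧ x < σ x ∧ P x (σ x)) ∧
      ∀ τ, (A'.filter fun x => x ≤ τ ∧ τ ≤ σ x).card ≤ K + 2 := by
  classical
  let A' := A.filter fun x => ∃ z ∈ A, x < z ∧ P x z
  have hσ : ∀ x ∈ A', ∃ w ∈ A, x < w ∧ P x w ∧
      (A.filter fun z => x < z ∧ z ≤ w).card ≤ K + 1 := by
    intro x hx
    obtain ⟨z, hz, hxz, hP⟩ := (Finset.mem_filter.1 hx).2
    obtain ⟨w, hw, hmin⟩ := (A.filter fun z => x < z ∧ P x z).exists_min_image (fun z => z)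
      ⟨z, Finset.mem_filter.2 ⟨hz, hxz, hP⟩⟩
    obtain ⟨hwA, hxw, hPw⟩ := Finset.mem_filter.1 hw
    refine ⟨w, hwA, hxw, hPw, ?_⟩
    have h := h₂ x ⟨w, hPw⟩ (A.filter fun z => x < z ∧ z < w) fun z hz hPz => by
      obtain ⟨hzA, hxz, hzw⟩ := Finset.mem_filter.1 hz
      exact absurd (hmin z (Finset.mem_filter.2 ⟨hzA, hxz, hPz⟩)) (not_le.2 hzw)
    have hsub : (A.filter fun z => x < z ∧ z ≤ w) ⊆ insert w (A.filter fun z => x < z ∧ z < w) := by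
      intro z hz
      obtain ⟨hzA, hxz, hzw⟩ := Finset.mem_filter.1 hz
      rcases hzw.eq_or_lt with rfl | hlt
      · exact Finset.mem_insert_self _ _
      · exact Finset.mem_insert_of_mem (Finset.mem_filter.2 ⟨hzA, hxz, hlt⟩)
    exact (Finset.card_le_card hsub).trans ((Finset.card_insert_le _ _).trans (by omega))
  choose! σ hσA hσlt hσP hσcard using hσ
  refine ⟨A', Finset.filter_subset _ _, σ, ?_, fun x hx => ⟨hσA x hx, hσlt x hx, hσP x hx⟩, ?_⟩
  · let E₁ := A.filter fun x => ∀ z, ¬ P x z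
    let E₂ := A.filter fun x => (A.filter fun z => x < z).card ≤ K
    have hE₁ : E₁.card ≤ K := h₁ E₁ fun x hx => (Finset.mem_filter.1 hx).2
    have hE₂ : E₂.card ≤ K + 1 := by
      rcases E₂.eq_empty_or_nonempty with h | h
      · simp [h]
      · obtain ⟨m, hm, hmin⟩ := E₂.exists_min_image (fun z => z) h
        have hsub : E₂ ⊆ insert m (A.filter fun z => m < z) := fun z hz => by
          rcases (hmin z hz).eq_or_lt with rfl | hlt
          · exact Finset.mem_insert_self _ _
          · exact Finset.mem_insert_of_mem
              (Finset.mem_filter.2 ⟨(Finset.mem_filter.1 hz).1, hlt⟩)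
        have := (Finset.mem_filter.1 hm).2
        exact (Finset.card_le_card hsub).trans ((Finset.card_insert_le _ _).trans (by omega))
    have hcover : A ⊆ A' ∪ (E₁ ∪ E₂) := by
      intro x hx
      by_contra hcon
      simp only [Finset.mem_union, not_or] at hcon
      obtain ⟨hx', hx₁, hx₂⟩ := hcon
      have hz : ∃ z, P x z := by
        by_contra! h
        exact hx₁ (Finset.mem_filter.2 ⟨hx, h⟩)
      refine hx₂ (Finset.mem_filter.2 ⟨hx, h₂ x hz _ fun z hz' hPz => ?_⟩)
      obtain ⟨hzA, hxz⟩ := Finset.mem_filter.1 hz'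
      exact hx' (Finset.mem_filter.2 ⟨hx, z, hzA, hxz, hPz⟩)
    have := (Finset.card_le_card hcover).trans (Finset.card_union_le _ _)
    have := Finset.card_union_le E₁ E₂
    omega
  · intro τ
    rcases (A'.filter fun x => x ≤ τ ∧ τ ≤ σ x).eq_empty_or_nonempty with h | h
    · simp [h]
    · obtain ⟨m, hm, hmin⟩ := Finset.exists_min_image _ (fun z => z) h
      obtain ⟨hmA, -, hmσ⟩ := Finset.mem_filter.1 hm
      have hsub : (A'.filter fun x => x ≤ τ ∧ τ ≤ σ x) ⊆
          insert m (A.filter fun z => m < z ∧ z ≤ σ m) := fun z hz => by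
        obtain ⟨hzA, hzτ, -⟩ := Finset.mem_filter.1 hz
        rcases (hmin z hz).eq_or_lt with rfl | hlt
        · exact Finset.mem_insert_self _ _
        · exact Finset.mem_insert_of_mem
            (Finset.mem_filter.2 ⟨Finset.filter_subset _ _ hzA, hlt, hzτ.trans hmσ⟩)
      have := hσcard m hmA
      exact (Finset.card_le_card hsub).trans ((Finset.card_insert_le _ _).trans (by omega))

/-- A polynomial function changes blocks rarely along short disjoint steps. -/
lemma card_block_changes_le {n M : ℕ} {g : ℝ → ℝ} (hg : IsPolyFun n g) {A' Θ : Finset ℝ}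
    {σ : ℝ → ℝ} {β : ℝ → ℕ} (hσ : ∀ x ∈ A', x < σ x)
    (hM : ∀ τ, (A'.filter fun x => x ≤ τ ∧ τ ≤ σ x).card ≤ M)
    (hβ : ∀ u v, β u ≠ β v → ∃ θ ∈ Θ, θ ∈ Set.uIcc u v) :
    (A'.filter fun x => β (g x) ≠ β (g (σ x))).card ≤ Θ.card * (n * M) := by
  classical
  by_cases hconst : ∀ x y, g x = g y
  · rw [Finset.filter_false_of_mem fun x _ => by simp [hconst x (σ x)]]
    simp
  have hroots : ∀ θ, ∃ Z : Finset ℝ, Z.card ≤ n ∧ ∀ x, g x = θ → x ∈ Z := by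
    intro θ
    have hsub : IsPolyFun n fun x => g x - θ := hg.sub (IsPolyFun.const n θ)
    obtain ⟨x₀, hx₀⟩ : ∃ x₀, g x₀ - θ ≠ 0 := by
      by_contra! h
      exact hconst fun x y => by linarith [h x, h y]
    have hfin : {x | g x = θ}.Finite := by
      by_contra hinf
      obtain ⟨s, hs, hcard⟩ := Set.Infinite.exists_subset_card_eq hinf (n + 1)
      have := hsub.card_le_of_forall_eq_zero hx₀ (s := s) fun x hx => sub_eq_zero.2 (hs hx)
      omega
    refine ⟨hfin.toFinset, ?_, by simp⟩
    exact hsub.card_le_of_forall_eq_zero hx₀ fun x hx => sub_eq_zero.2 (by simpa using hx)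
  choose Z hZcard hZ using hroots
  have hcover : (A'.filter fun x => β (g x) ≠ β (g (σ x))) ⊆
      Θ.biUnion fun θ => (Z θ).biUnion fun z => A'.filter fun x => x ≤ z ∧ z ≤ σ x := by
    intro x hx
    obtain ⟨hxA, hne⟩ := Finset.mem_filter.1 hx
    obtain ⟨θ, hθ, hθu⟩ := hβ _ _ hne
    obtain ⟨z, hz, hzθ⟩ := intermediate_value_uIcc hg.continuous.continuousOn hθu
    rw [Set.uIcc_of_le (hσ x hxA).le] at hz
    simp only [Finset.mem_biUnion, Finset.mem_filter]
    exact ⟨θ, hθ, z, hZ θ z hzθ, hxA, hz⟩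
  refine (Finset.card_le_card hcover).trans (Finset.card_biUnion_le_card_mul _ _ _ fun θ _ => ?_)
  exact (Finset.card_biUnion_le_card_mul _ _ _ fun z _ => hM z).trans
    (Nat.mul_le_mul_right M (hZcard θ))

/-- `F` is a polynomial function on the plane with partial derivatives `Fx` and `Fy`, all of degree
at most `k` in each variable. -/
structure IsPlanePoly (k : ℕ) (F Fx Fy : ℝ → ℝ → ℝ) : Prop where
  isPolyFun₂ : IsPolyFun₂ k F
  isPolyFun₂_fst : IsPolyFun₂ k Fx
  isPolyFun₂_snd : IsPolyFun₂ k Fy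
  hasStrictFDerivAt : ∀ x y, HasStrictFDerivAt (fun p : ℝ × ℝ => F p.1 p.2)
    (Fx x y • ContinuousLinearMap.fst ℝ ℝ ℝ + Fy x y • ContinuousLinearMap.snd ℝ ℝ ℝ) (x, y)

/-- The Jacobian determinant of `(F x y, F x' y)` along horizontal translations. -/
def translateJacobian (Fx Fy : ℝ → ℝ → ℝ) (x x' y : ℝ) : ℝ :=
  Fx x y * Fy x' y - Fy x y * Fx x' y

namespace IsPlanePoly

variable {k : ℕ} {F Fx Fy : ℝ → ℝ → ℝ}

lemma swap (h : IsPlanePoly k F Fx Fy) :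
    IsPlanePoly k (fun x y => F y x) (fun x y => Fy y x) (fun x y => Fx y x) where
  isPolyFun₂ := ⟨h.isPolyFun₂.2, h.isPolyFun₂.1⟩
  isPolyFun₂_fst := ⟨h.isPolyFun₂_snd.2, h.isPolyFun₂_snd.1⟩
  isPolyFun₂_snd := ⟨h.isPolyFun₂_fst.2, h.isPolyFun₂_fst.1⟩
  hasStrictFDerivAt x y := by
    have hs : HasStrictFDerivAt (fun q : ℝ × ℝ => (q.2, q.1))
        ((ContinuousLinearMap.snd ℝ ℝ ℝ).prod (ContinuousLinearMap.fst ℝ ℝ ℝ)) (x, y) :=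
      hasStrictFDerivAt_snd.prodMk hasStrictFDerivAt_fst
    have := (h.hasStrictFDerivAt y x).comp (x, y) hs
    refine this.congr_fderiv ?_
    ext <;> simp

lemma hasDerivAt_fst (h : IsPlanePoly k F Fx Fy) (x y : ℝ) :
    HasDerivAt (fun x => F x y) (Fx x y) x := by
  have := (h.hasStrictFDerivAt x y).hasFDerivAt.comp_hasDerivAt x
    ((hasDerivAt_id x).prodMk (hasDerivAt_const x y))
  exact this.congr_deriv (by simp)

lemma isPolyFun_jacobian_fst (h : IsPlanePoly k F Fx Fy) (x' y : ℝ) :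
    IsPolyFun (2 * k) fun x => translateJacobian Fx Fy x x' y :=
  (((h.isPolyFun₂_fst.1 y).mul (IsPolyFun.const k _)).sub
    ((h.isPolyFun₂_snd.1 y).mul (IsPolyFun.const k _))).mono (by omega)

lemma isPolyFun_jacobian_snd (h : IsPlanePoly k F Fx Fy) (x y : ℝ) :
    IsPolyFun (2 * k) fun x' => translateJacobian Fx Fy x x' y :=
  (((IsPolyFun.const k _).mul (h.isPolyFun₂_snd.1 y)).sub
    ((IsPolyFun.const k _).mul (h.isPolyFun₂_fst.1 y))).mono (by omega)

lemma isPolyFun_jacobian_thd (h : IsPlanePoly k F Fx Fy) (x x' : ℝ) :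
    IsPolyFun (2 * k) fun y => translateJacobian Fx Fy x x' y :=
  (((h.isPolyFun₂_fst.2 x).mul (h.isPolyFun₂_snd.2 x')).sub
    ((h.isPolyFun₂_snd.2 x).mul (h.isPolyFun₂_fst.2 x'))).mono (by omega)

lemma card_translate_fiber_le (h : IsPlanePoly k F Fx Fy) (hk : 0 < k) {d v v' : ℝ}
    {T : Finset (ℝ × ℝ)} (hT : ∀ p ∈ T, F p.1 p.2 = v ∧ F (p.1 + d) p.2 = v' ∧
      translateJacobian Fx Fy p.1 (p.1 + d) p.2 ≠ 0) : T.card ≤ (3 * k) ^ 2 * (3 * k) ^ 2 := by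
  have hF' : IsPolyFun₂ k fun x y => F (x + d) y :=
    ⟨fun y => (h.isPolyFun₂.1 y).comp_add_const d, fun x => h.isPolyFun₂.2 (x + d)⟩
  have hmap : ∀ p ∈ T, Filter.map (fun q : ℝ × ℝ => (F q.1 q.2, F (q.1 + d) q.2)) (nhds p) =
      nhds (v, v') := by
    rintro ⟨x, y⟩ hp
    obtain ⟨h₁, h₂, hJ⟩ := hT _ hp
    have hshift : HasStrictFDerivAt (fun q : ℝ × ℝ => (q.1 + d, q.2))
        ((ContinuousLinearMap.fst ℝ ℝ ℝ).prod (ContinuousLinearMap.snd ℝ ℝ ℝ)) (x, y) :=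
      (hasStrictFDerivAt_fst.add_const d).prodMk hasStrictFDerivAt_snd
    have hd := (h.hasStrictFDerivAt x y).prodMk
      ((h.hasStrictFDerivAt (x + d) y).comp (x, y) hshift)
    have := hd.map_nhds_eq_of_surj (range_prod_smul_eq_top hJ)
    rw [show ((v, v') : ℝ × ℝ) = (F x y, F (x + d) y) from Prod.ext h₁.symm h₂.symm]
    exact this
  have h₁ := card_image_le_of_nondegenerate hk h.isPolyFun₂ hF' (l := fun x _ => x)
    ⟨fun _ => IsPolyFun.id.mono hk, fun x => IsPolyFun.const k x⟩ continuous_fst hmap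
  have h₂ := card_image_le_of_nondegenerate hk h.isPolyFun₂ hF' (l := fun _ y => y)
    ⟨fun y => IsPolyFun.const k y, fun _ => IsPolyFun.id.mono hk⟩ continuous_snd hmap
  calc T.card ≤ ((T.image fun p => p.1) ×ˢ (T.image fun p => p.2)).card :=
        Finset.card_le_card fun p hp => Finset.mem_product.2
          ⟨Finset.mem_image_of_mem _ hp, Finset.mem_image_of_mem _ hp⟩
    _ ≤ _ := by
        rw [Finset.card_product]
        exact Nat.mul_le_mul h₁ h₂

/-- The incidence count behind the sum-expander bound, for arbitrary block sizes `s` and `t`. -/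
lemma card_incidences_le (h : IsPlanePoly k F Fx Fy) (hk : 0 < k) {A A' : Finset ℝ} (hA' : A' ⊆ A)
    {σ : ℝ → ℝ} {K : ℕ} (hσ : ∀ x ∈ A', σ x ∈ A ∧ x < σ x ∧
      ∃ y, translateJacobian Fx Fy x (σ x) y ≠ 0)
    (hK : ∀ τ, (A'.filter fun x => x ≤ τ ∧ τ ≤ σ x).card ≤ K) {s t : ℕ} (hs : 0 < s)
    (ht : 0 < t) :
    A.card * A.card * A'.card ≤
      (3 * k) ^ 2 * (3 * k) ^ 2 * (((A + A).card * s) * ((Finset.image₂ F A A).card * t)) +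
      (2 * k * (A.card * A'.card) + (((A + A).card / s + 1) * (1 * K) * (A.card * A.card) +
        ((Finset.image₂ F A A).card / t + 1) * (k * K) * (A.card * A.card))) := by
  classical
  obtain ⟨Θ, β, hΘ, hβ, hβcard⟩ := exists_block_partition (A + A) hs
  obtain ⟨Ξ, γ, hΞ, hγ, hγcard⟩ := exists_block_partition (Finset.image₂ F A A) ht
  set B := A + A with hB
  set C := Finset.image₂ F A A with hC
  let X := A ×ˢ A ×ˢ A'
  let E₁ := X.filter fun p => translateJacobian Fx Fy p.2.2 (σ p.2.2) p.2.1 = 0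
  let E₂ := X.filter fun p => β (p.2.2 + p.1) ≠ β (σ p.2.2 + p.1)
  let E₃ := X.filter fun p => γ (F p.2.2 p.2.1) ≠ γ (F (σ p.2.2) p.2.1)
  let G := X.filter fun p => translateJacobian Fx Fy p.2.2 (σ p.2.2) p.2.1 ≠ 0 ∧
    β (p.2.2 + p.1) = β (σ p.2.2 + p.1) ∧ γ (F p.2.2 p.2.1) = γ (F (σ p.2.2) p.2.1)
  have hE₁ : E₁.card ≤ 2 * k * (A.card * A'.card) := by
    rw [← Finset.card_product]
    refine Finset.card_le_mul_card_image_of_maps_to (f := fun p => (p.1, p.2.2))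
      (fun p hp => ?_) _ fun q hq => ?_
    · simp only [E₁, X, Finset.mem_filter, Finset.mem_product] at hp ⊢
      exact ⟨hp.1.1, hp.1.2.2⟩
    · obtain ⟨y, hy⟩ := (hσ q.2 (Finset.mem_product.1 hq).2).2.2
      have hinj : Set.InjOn (fun p : ℝ × ℝ × ℝ => p.2.1)
          (E₁.filter fun p => (p.1, p.2.2) = q : Finset _) := by
        rintro ⟨a, b, x⟩ hp ⟨a', b', x'⟩ hp' hb
        have e := (Finset.mem_filter.1 hp).2.trans (Finset.mem_filter.1 hp').2.symm
        simp only [Prod.mk.injEq] at e hb ⊢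
        exact ⟨e.1, hb, e.2⟩
      rw [← Finset.card_image_of_injOn hinj]
      refine (h.isPolyFun_jacobian_thd q.2 (σ q.2)).card_le_of_forall_eq_zero hy fun b hb => ?_
      obtain ⟨p, hp, rfl⟩ := Finset.mem_image.1 hb
      obtain ⟨hpf, rfl⟩ := Finset.mem_filter.1 hp
      exact (Finset.mem_filter.1 hpf).2
  have hfiber : ∀ (Q : ℝ × ℝ × ℝ → Prop) [DecidablePred Q] (N : ℕ),
      (∀ a ∈ A, ∀ b ∈ A, (A'.filter fun x => Q (a, b, x)).card ≤ N) →
      (X.filter Q).card ≤ N * (A.card * A.card) := by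
    intro Q _ N hQ
    rw [← Finset.card_product]
    refine Finset.card_le_mul_card_image_of_maps_to (f := fun p => (p.1, p.2.1))
      (fun p hp => ?_) _ fun q hq => ?_
    · simp only [X, Finset.mem_filter, Finset.mem_product] at hp ⊢
      exact ⟨hp.1.1, hp.1.2.1⟩
    · refine le_trans ?_ (hQ q.1 (Finset.mem_product.1 hq).1 q.2 (Finset.mem_product.1 hq).2)
      refine Finset.card_le_card_of_injOn (fun p => p.2.2) (fun p hp => ?_) ?_
      · obtain ⟨hpf, rfl⟩ := Finset.mem_filter.1 hp
        obtain ⟨hpX, hpQ⟩ := Finset.mem_filter.1 hpf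
        simp only [X, Finset.mem_product] at hpX
        exact Finset.mem_coe.2 (Finset.mem_filter.2 ⟨hpX.2.2, hpQ⟩)
      · rintro ⟨a, b, x⟩ hp ⟨a', b', x'⟩ hp' hx
        have e := (Finset.mem_filter.1 hp).2.trans (Finset.mem_filter.1 hp').2.symm
        simp only [Prod.mk.injEq] at e hx ⊢
        exact ⟨e.1, e.2, hx⟩
  have hE₂ : E₂.card ≤ (B.card / s + 1) * (1 * K) * (A.card * A.card) :=
    hfiber (fun p => β (p.2.2 + p.1) ≠ β (σ p.2.2 + p.1)) _ fun a _ b _ =>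
      (card_block_changes_le (IsPolyFun.id.comp_add_const a)
      (fun x hx => (hσ x hx).2.1) hK hβ).trans (Nat.mul_le_mul_right _ hΘ)
  have hE₃ : E₃.card ≤ (C.card / t + 1) * (k * K) * (A.card * A.card) :=
    hfiber (fun p => γ (F p.2.2 p.2.1) ≠ γ (F (σ p.2.2) p.2.1)) _ fun a _ b _ =>
      (card_block_changes_le (h.isPolyFun₂.1 b)
      (fun x hx => (hσ x hx).2.1) hK hγ).trans (Nat.mul_le_mul_right _ hΞ)
  have hG : G.card ≤ (3 * k) ^ 2 * (3 * k) ^ 2 * ((B.card * s) * (C.card * t)) := by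
    refine le_trans ?_ (Nat.mul_le_mul_left _ (Nat.mul_le_mul hβcard hγcard))
    rw [← Finset.card_product]
    refine Finset.card_le_mul_card_image_of_maps_to
      (f := fun p => ((p.2.2 + p.1, σ p.2.2 + p.1), (F p.2.2 p.2.1, F (σ p.2.2) p.2.1)))
      (fun p hp => ?_) _ fun q _ => ?_
    · simp only [G, X, Finset.mem_filter, Finset.mem_product] at hp ⊢
      obtain ⟨⟨ha, hb, hx⟩, -, hβp, hγp⟩ := hp
      exact ⟨⟨⟨Finset.add_mem_add (hA' hx) ha, Finset.add_mem_add (hσ _ hx).1 ha⟩, hβp⟩,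
        ⟨Finset.mem_image₂_of_mem (hA' hx) hb, Finset.mem_image₂_of_mem (hσ _ hx).1 hb⟩, hγp⟩
    · have hinj : Set.InjOn (fun p : ℝ × ℝ × ℝ => (p.2.2, p.2.1))
          (G.filter fun p => ((p.2.2 + p.1, σ p.2.2 + p.1),
            (F p.2.2 p.2.1, F (σ p.2.2) p.2.1)) = q : Finset _) := by
        rintro ⟨a, b, x⟩ hp ⟨a', b', x'⟩ hp' hb
        have e := (Finset.mem_filter.1 hp).2.trans (Finset.mem_filter.1 hp').2.symm
        simp only [Prod.mk.injEq] at e hb ⊢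
        exact ⟨by linarith [e.1.1, hb.1], hb.2, hb.1⟩
      rw [← Finset.card_image_of_injOn hinj]
      refine h.card_translate_fiber_le hk (d := q.1.2 - q.1.1) (v := q.2.1) (v' := q.2.2)
        fun r hr => ?_
      obtain ⟨p, hp, rfl⟩ := Finset.mem_image.1 hr
      obtain ⟨hpf, rfl⟩ := Finset.mem_filter.1 hp
      have hJ := (Finset.mem_filter.1 hpf).2.1
      have hd : p.2.2 + (σ p.2.2 + p.1 - (p.2.2 + p.1)) = σ p.2.2 := by ring
      simp only [hd]
      exact ⟨trivial, trivial, hJ⟩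
  have hcover : X ⊆ G ∪ (E₁ ∪ (E₂ ∪ E₃)) := by
    intro p hp
    simp only [G, E₁, E₂, E₃, Finset.mem_union, Finset.mem_filter, hp, true_and]
    tauto
  have hX : X.card = A.card * A.card * A'.card := by
    simp only [X, Finset.card_product, mul_assoc]
  have := (Finset.card_le_card hcover).trans (Finset.card_union_le _ _)
  have := Finset.card_union_le E₁ (E₂ ∪ E₃)
  have := Finset.card_union_le E₂ E₃
  rw [← hX]
  omega

/-- The quantitative sum-expander bound for large sets. -/
lemma card_pow_five_le (h : IsPlanePoly k F Fx Fy) (hk : 0 < k)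
    (hJ : ∃ x x' y, translateJacobian Fx Fy x x' y ≠ 0) {A : Finset ℝ}
    (hA : 16 * (k + 1) ^ 2 ≤ A.card) :
    A.card ^ 5 ≤ 2048 * (k + 1) ^ 4 * ((3 * k) ^ 2 * (3 * k) ^ 2) *
      ((A + A).card * (Finset.image₂ F A A).card) ^ 2 := by
  classical
  obtain ⟨x₀, x₀', y₀, hJ₀⟩ := hJ
  obtain ⟨A', hA'A, σ, hA', hσ, hK⟩ := exists_successor A
    (fun x z => ∃ y, translateJacobian Fx Fy x z y ≠ 0) (K := 2 * k)
    (fun S hS => (h.isPolyFun_jacobian_fst x₀' y₀).card_le_of_forall_eq_zero hJ₀ fun x hx => by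
      by_contra hne
      exact hS x hx x₀' ⟨y₀, hne⟩)
    (fun x hx S hS => by
      obtain ⟨z, y, hzy⟩ := hx
      refine (h.isPolyFun_jacobian_snd x y).card_le_of_forall_eq_zero hzy fun z' hz' => ?_
      by_contra hne
      exact hS z' hz' ⟨y, hne⟩)
  set n := A.card with hn
  have hnk : 12 * k + 4 ≤ n := by nlinarith
  have hnC : n ≤ k * (Finset.image₂ F A A).card := by
    obtain ⟨x, hx⟩ : A'.Nonempty := Finset.card_pos.1 (by omega)
    obtain ⟨y, hy⟩ := (hσ x hx).2.2
    obtain ⟨b, hb, hJb⟩ : ∃ b ∈ A, translateJacobian Fx Fy x (σ x) b ≠ 0 := by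
      by_contra! hzero
      have := (h.isPolyFun_jacobian_thd x (σ x)).card_le_of_forall_eq_zero hy hzero
      omega
    obtain ⟨x₁, hx₁⟩ : ∃ x₁, Fx x₁ b ≠ 0 := by
      by_contra! hzero
      simp [translateJacobian, hzero] at hJb
    have hfib := Finset.card_le_mul_card_image (f := fun x => F x b) A k fun c _ => by
      obtain ⟨x₂, hx₂⟩ : ∃ x₂, F x₂ b - c ≠ 0 := by
        by_contra! hzero
        refine hx₁ ((h.hasDerivAt_fst x₁ b).unique ?_)
        rw [show (fun x => F x b) = fun _ => c from funext fun x => sub_eq_zero.1 (hzero x)]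
        exact hasDerivAt_const x₁ c
      exact ((h.isPolyFun₂.1 b).sub (IsPolyFun.const k c)).card_le_of_forall_eq_zero hx₂
        fun x hx => sub_eq_zero.2 (Finset.mem_filter.1 hx).2
    refine hfib.trans (Nat.mul_le_mul_left k (Finset.card_le_card ?_))
    rintro _ hc
    obtain ⟨a, ha, rfl⟩ := Finset.mem_image.1 hc
    exact Finset.mem_image₂_of_mem ha hb
  have hnB : n ≤ (A + A).card := by
    have : A.Nonempty := Finset.card_pos.1 (by omega)
    exact Finset.card_le_card_add_left this
  set b := (A + A).card
  set c := (Finset.image₂ F A A).card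
  set E := 2 * (k + 1) ^ 2 with hE
  set M := (3 * k) ^ 2 * (3 * k) ^ 2
  have hE4 : 0 < 4 * E := by positivity
  have hEn : 8 * E ≤ n := by rw [hE]; linarith
  set r := n / (4 * E) with hr
  have hr4 : 4 * E * r ≤ n := Nat.mul_div_le n (4 * E)
  have hr8 : n ≤ 8 * E * r := by
    have h₁ := Nat.lt_mul_div_succ n hE4
    have h₂ : 1 ≤ r := (Nat.one_le_div_iff hE4).2 (by linarith)
    rw [← hr] at h₁
    nlinarith
  have hr0 : 0 < r := by
    refine Nat.pos_of_ne_zero fun h0 => ?_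
    rw [h0, mul_zero] at hr8
    linarith
  have hrb : r ≤ b := by nlinarith
  have hrc : r ≤ c := by
    have : k ≤ 4 * E := by nlinarith
    have h₁ : 4 * E * r ≤ 4 * E * c := hr4.trans (hnC.trans (Nat.mul_le_mul_right c this))
    exact Nat.le_of_mul_le_mul_left h₁ hE4
  have hdiv : ∀ m, m / (m / r + 1) + 1 ≤ r := fun m => by
    have := Nat.lt_mul_div_succ m hr0
    exact Nat.div_lt_of_lt_mul (by rw [mul_comm]; exact this)
  have hmul : ∀ m, r ≤ m → (m / r + 1) * r ≤ 2 * m := fun m hm => by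
    have := Nat.div_mul_le_self m r
    nlinarith
  set s := b / r + 1
  set t := c / r + 1
  have hmain : n * n * A'.card ≤ M * (b * s * (c * t)) +
      (2 * k * (n * A'.card) + ((b / s + 1) * (1 * (2 * k + 2)) * (n * n) +
        (c / t + 1) * (k * (2 * k + 2)) * (n * n))) :=
    h.card_incidences_le hk hA'A hσ hK (Nat.succ_pos _) (Nat.succ_pos _)
  have hs : s * r ≤ 2 * b := hmul b hrb
  have ht : t * r ≤ 2 * c := hmul c hrc
  have hsb : b / s + 1 ≤ r := hdiv b
  have htc : c / t + 1 ≤ r := hdiv c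
  have hA'n : A'.card ≤ n := Finset.card_le_card hA'A
  have hcubic : n ^ 3 ≤ 2 * M * (b * s * (c * t)) := by
    have e₁ : (b / s + 1) * (1 * (2 * k + 2)) * (n * n) ≤ r * (1 * (2 * k + 2)) * (n * n) := by
      gcongr
    have e₂ : (c / t + 1) * (k * (2 * k + 2)) * (n * n) ≤ r * (k * (2 * k + 2)) * (n * n) := by
      gcongr
    have e₃ : 2 * k * (n * A'.card) ≤ 2 * k * (n * n) := by gcongr
    have e₄ : n * n * n ≤ n * n * (A'.card + (2 * (2 * k) + 1)) := by gcongr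
    have e₅ : n * n * (4 * E * r) ≤ n * n * n := by gcongr
    have e₆ : n * n * (24 * k + 4) ≤ n * n * n := by
      gcongr
      nlinarith
    have hEr : r * (1 * (2 * k + 2)) * (n * n) + r * (k * (2 * k + 2)) * (n * n) =
        n * n * (E * r) := by rw [hE]; ring
    linarith
  calc n ^ 5 = n ^ 3 * n ^ 2 := by ring
    _ ≤ (2 * M * (b * s * (c * t))) * (8 * E * r) ^ 2 := by gcongr
    _ = 128 * E ^ 2 * M * (b * c) * ((s * r) * (t * r)) := by ring
    _ ≤ 128 * E ^ 2 * M * (b * c) * ((2 * b) * (2 * c)) := by gcongr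
    _ = 2048 * (k + 1) ^ 4 * M * (b * c) ^ 2 := by rw [hE]; ring

end IsPlanePoly

section MvPolynomial

open MvPolynomial

lemma MvPolynomial.totalDegree_pderiv_le {σ R : Type*} [CommSemiring R] (i : σ)
    (f : MvPolynomial σ R) : (pderiv i f).totalDegree ≤ f.totalDegree := by
  conv_lhs => rw [f.as_sum, map_sum]
  refine totalDegree_finsetSum_le fun s hs => ?_
  rw [pderiv_monomial]
  refine (totalDegree_monomial_le _ _).trans ((?_ : _ ≤ s.degree).trans (le_totalDegree hs))
  exact Finsupp.degree_mono tsub_le_self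

lemma isPolyFun₂_eval {k : ℕ} {f : MvPolynomial (Fin 2) ℝ} (hf : f.totalDegree ≤ k) :
    IsPolyFun₂ k fun x y => eval ![x, y] f := by
  have key : ∀ v : Fin 2 → Polynomial ℝ, (∀ i, (v i).natDegree ≤ 1) →
      IsPolyFun k fun t => eval (fun i => (v i).eval t) f := by
    intro v hv
    refine ⟨aeval v f, by simpa using aeval_natDegree_le f hf v hv, fun t => ?_⟩
    have : (Polynomial.evalRingHom t).comp (aeval v).toRingHom =
        eval (fun i => (v i).eval t) := by
      refine MvPolynomial.ringHom_ext (fun r => ?_) fun i => ?_ <;> simp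
    exact (RingHom.congr_fun this f).symm
  constructor
  · intro y
    convert key ![Polynomial.X, Polynomial.C y] (by simp [Fin.forall_fin_two]) using 3 with t
    congr 1
    funext i
    fin_cases i <;> simp
  · intro x
    convert key ![Polynomial.C x, Polynomial.X] (by simp [Fin.forall_fin_two]) using 3 with t
    congr 1
    funext i
    fin_cases i <;> simp

lemma hasStrictFDerivAt_eval (f : MvPolynomial (Fin 2) ℝ) (x y : ℝ) :
    HasStrictFDerivAt (fun p : ℝ × ℝ => eval ![p.1, p.2] f)
      (eval ![x, y] (pderiv 0 f) • ContinuousLinearMap.fst ℝ ℝ ℝ +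
        eval ![x, y] (pderiv 1 f) • ContinuousLinearMap.snd ℝ ℝ ℝ) (x, y) := by
  induction f using MvPolynomial.induction_on with
  | C a =>
    simp only [eval_C, pderiv_C, map_zero, zero_smul, add_zero]
    exact hasStrictFDerivAt_const a (x, y)
  | add p q hp hq =>
    simp only [map_add]
    refine (hp.add hq).congr_fderiv ?_
    ext <;> simp
  | mul_X p i hp =>
    simp only [map_mul, eval_X]
    have hi : HasStrictFDerivAt (fun q : ℝ × ℝ => ![q.1, q.2] i)
        (![ContinuousLinearMap.fst ℝ ℝ ℝ, ContinuousLinearMap.snd ℝ ℝ ℝ] i) (x, y) := by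
      fin_cases i
      · exact hasStrictFDerivAt_fst
      · exact hasStrictFDerivAt_snd
    refine (hp.mul hi).congr_fderiv ?_
    fin_cases i <;> ext <;> simp [pderiv_X]

lemma isPlanePoly_eval {k : ℕ} {f : MvPolynomial (Fin 2) ℝ} (hf : f.totalDegree ≤ k) :
    IsPlanePoly k (fun x y => eval ![x, y] f) (fun x y => eval ![x, y] (pderiv 0 f))
      (fun x y => eval ![x, y] (pderiv 1 f)) where
  isPolyFun₂ := isPolyFun₂_eval hf
  isPolyFun₂_fst := isPolyFun₂_eval ((totalDegree_pderiv_le 0 f).trans hf)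
  isPolyFun₂_snd := isPolyFun₂_eval ((totalDegree_pderiv_le 1 f).trans hf)
  hasStrictFDerivAt := hasStrictFDerivAt_eval f

lemma isDegenerate_of_parallel_gradient {f : MvPolynomial (Fin 2) ℝ} {α β : ℝ}
    (hαβ : α * α + β * β ≠ 0)
    (h : ∀ x y, α * eval ![x, y] (pderiv 1 f) = β * eval ![x, y] (pderiv 0 f)) :
    IsDegenerate f := by
  set Δ := α * α + β * β with hΔ
  refine ⟨aeval ![Polynomial.C (α / Δ) * Polynomial.X, Polynomial.C (β / Δ) * Polynomial.X] f,
    α, β, fun x y => ?_⟩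
  have hcomp : ∀ s : ℝ, (aeval ![Polynomial.C (α / Δ) * Polynomial.X,
      Polynomial.C (β / Δ) * Polynomial.X] f).eval s = eval ![α / Δ * s, β / Δ * s] f := by
    intro s
    have : (Polynomial.evalRingHom s).comp (aeval ![Polynomial.C (α / Δ) * Polynomial.X,
        Polynomial.C (β / Δ) * Polynomial.X]).toRingHom =
        eval ![α / Δ * s, β / Δ * s] := by
      refine MvPolynomial.ringHom_ext (fun r => by simp) fun i => ?_
      fin_cases i <;> simp
    exact RingHom.congr_fun this f
  rw [hcomp]
  set s := α * x + β * y with hs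
  let G : ℝ → ℝ := fun t => eval ![α / Δ * s - β * t, β / Δ * s + α * t] f
  have hG : ∀ t, HasDerivAt G 0 t := by
    intro t
    have h₁ : HasDerivAt (fun t => (α / Δ * s - β * t, β / Δ * s + α * t)) (-β, α) t := by
      refine HasDerivAt.prodMk ?_ ?_
      · simpa using ((hasDerivAt_id t).const_mul β).const_sub (α / Δ * s)
      · simpa using ((hasDerivAt_id t).const_mul α).const_add (β / Δ * s)
    have h₂ := (hasStrictFDerivAt_eval f (α / Δ * s - β * t)
      (β / Δ * s + α * t)).hasFDerivAt.comp_hasDerivAt t h₁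
    refine h₂.congr_deriv ?_
    have := h (α / Δ * s - β * t) (β / Δ * s + α * t)
    simp
    linarith
  have hconst := is_const_of_deriv_eq_zero (fun t => (hG t).differentiableAt)
    (fun t => (hG t).deriv) ((α * y - β * x) / Δ) 0
  simp only [G, mul_zero, sub_zero, add_zero] at hconst
  rw [← hconst]
  congr 2
  ext i
  fin_cases i
  · simp only [hs, Fin.zero_eta, Matrix.cons_val_zero]
    field_simp
    rw [hΔ]
    ring
  · simp only [hs, Fin.mk_one, Matrix.cons_val_one, Matrix.cons_val_fin_one]
    field_simp
    rw [hΔ]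
    ring

/-- A polynomial all of whose translation Jacobians vanish, in both variables, is degenerate. -/
lemma isDegenerate_of_translateJacobian_eq_zero {f : MvPolynomial (Fin 2) ℝ}
    (h₁ : ∀ x x' y, translateJacobian (fun x y => eval ![x, y] (pderiv 0 f))
      (fun x y => eval ![x, y] (pderiv 1 f)) x x' y = 0)
    (h₂ : ∀ y y' x, translateJacobian (fun y x => eval ![x, y] (pderiv 1 f))
      (fun y x => eval ![x, y] (pderiv 0 f)) y y' x = 0) :
    IsDegenerate f := by
  have hf := isPlanePoly_eval (le_refl f.totalDegree)
  simp only [translateJacobian] at h₁ h₂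
  set Fx : ℝ → ℝ → ℝ := fun x y => eval ![x, y] (pderiv 0 f)
  set Fy : ℝ → ℝ → ℝ := fun x y => eval ![x, y] (pderiv 1 f)
  change ∀ x x' y, Fx x y * Fy x' y - Fy x y * Fx x' y = 0 at h₁
  change ∀ y y' x, Fy x y * Fx x y' - Fx x y * Fy x y' = 0 at h₂
  by_cases hgrad : ∀ x y, Fx x y = 0 ∧ Fy x y = 0
  · refine isDegenerate_of_parallel_gradient (α := 1) (β := 0) (by norm_num) fun x y => ?_
    have : Fy x y = 0 := (hgrad x y).2
    simpa using this
  obtain ⟨x₀, y₀, h₀⟩ : ∃ x₀ y₀, Fx x₀ y₀ ≠ 0 ∨ Fy x₀ y₀ ≠ 0 := by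
    by_contra! hzero
    exact hgrad hzero
  set α := Fx x₀ y₀ with hα
  set β := Fy x₀ y₀ with hβ
  have hαβ : α * α + β * β ≠ 0 := by
    intro hzero
    rcases h₀ with h | h <;> exact h (by nlinarith [mul_self_nonneg α, mul_self_nonneg β])
  refine isDegenerate_of_parallel_gradient hαβ fun x y => sub_eq_zero.1 ?_
  have hpoly : IsPolyFun (0 + f.totalDegree) fun x => α * Fy x y - β * Fx x y :=
    ((IsPolyFun.const 0 α).mul (hf.isPolyFun₂_snd.1 y)).sub
      ((IsPolyFun.const 0 β).mul (hf.isPolyFun₂_fst.1 y))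
  rcases h₀ with h₀ | h₀
  · refine (hf.isPolyFun₂_fst.1 y₀).eq_zero_or_eq_zero hpoly (fun z => ?_) h₀ x
    linear_combination (-α) * h₂ y₀ y z + Fx z y * h₁ x₀ z y₀
  · refine (hf.isPolyFun₂_snd.1 y₀).eq_zero_or_eq_zero hpoly (fun z => ?_) h₀ x
    linear_combination (-β) * h₂ y₀ y z + Fy z y * h₁ x₀ z y₀

end MvPolynomial

lemma rpow_five_halves_le_of_pow_five_le {n N C : ℕ} (h : n ^ 5 ≤ C * N ^ 2) :
    (n : ℝ) ^ ((5 : ℝ) / 2) ≤ √C * N := by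
  have h' : ((n : ℝ) ^ 5) ≤ C * (N : ℝ) ^ 2 := by exact_mod_cast h
  calc (n : ℝ) ^ ((5 : ℝ) / 2) = √((n : ℝ) ^ 5) := by
        rw [Real.sqrt_eq_rpow, ← Real.rpow_natCast, ← Real.rpow_mul (Nat.cast_nonneg n)]
        norm_num
    _ ≤ √(C * (N : ℝ) ^ 2) := Real.sqrt_le_sqrt h'
    _ = √C * N := by
        rw [Real.sqrt_mul (Nat.cast_nonneg C), Real.sqrt_sq (Nat.cast_nonneg N)]

/-- Main theorem: for a non-degenerate `f` of total degree `k ≥ 2` there is `c > 0`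
depending only on `k` with `|A+A|·|f(A,A)| ≥ c·|A|^{5/2}` for every finite `A ⊆ ℝ`. -/
theorem sum_expander_product_bound (k : ℕ) (hk : 2 ≤ k) :
    ∃ c : ℝ, 0 < c ∧ ∀ f : MvPolynomial (Fin 2) ℝ,
      f.totalDegree = k → ¬ IsDegenerate f →
      ∀ A : Finset ℝ,
        c * (A.card : ℝ) ^ ((5 : ℝ) / 2) ≤
          ((A + A).card : ℝ) *
            ((Finset.image₂ (fun a b => MvPolynomial.eval ![a, b] f) A A).card : ℝ) := by
  set C := 2048 * (k + 1) ^ 4 * ((3 * k) ^ 2 * (3 * k) ^ 2) + (16 * (k + 1) ^ 2) ^ 5 with hC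
  have hC0 : 0 < √(C : ℝ) := Real.sqrt_pos.2 (by positivity)
  refine ⟨(√(C : ℝ))⁻¹, by positivity, fun f hf hdeg A => ?_⟩
  set F : ℝ → ℝ → ℝ := fun a b => MvPolynomial.eval ![a, b] f with hF
  suffices h : A.card ^ 5 ≤ C * ((A + A).card * (Finset.image₂ F A A).card) ^ 2 by
    rw [inv_mul_le_iff₀ hC0, ← Nat.cast_mul]
    exact rpow_five_halves_le_of_pow_five_le h
  rcases A.eq_empty_or_nonempty with rfl | hA
  · simp
  rcases lt_or_ge A.card (16 * (k + 1) ^ 2) with hsmall | hlarge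
  · have h₁ : 0 < (A + A).card := (hA.add hA).card_pos
    have h₂ : 0 < (Finset.image₂ F A A).card := (hA.image₂ hA).card_pos
    calc A.card ^ 5 ≤ (16 * (k + 1) ^ 2) ^ 5 := Nat.pow_le_pow_left hsmall.le 5
      _ ≤ C := Nat.le_add_left _ _
      _ ≤ _ := Nat.le_mul_of_pos_right C (by positivity)
  refine le_trans ?_ (Nat.mul_le_mul_right _ (Nat.le_add_right _ _))
  have hplane := isPlanePoly_eval hf.le
  by_contra hcon
  refine hdeg (isDegenerate_of_translateJacobian_eq_zero ?_ ?_)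
  · by_contra! hJ
    exact hcon (hplane.card_pow_five_le (by omega) hJ hlarge)
  · by_contra! hJ
    refine hcon ?_
    rw [Finset.image₂_swap]
    exact hplane.swap.card_pow_five_le (by omega) hJ hlarge
end

section
/- (Bezout's theorem, plane-curve form.) Let f, g ∈ ℂ[x,y] be nonzero polynomials of total degrees m and n respectively, and suppose f and g have no common non-constant factor in ℂ[x,y]. Then the set of common zeros {(a,b) ∈ ℂ² : f(a,b) = 0 and g(a,b) = 0} is finite and has cardinality at most m·n. -/
open MvPolynomial Module

section

variable {K : Type*} [Field K]

theorem two_mul_card_degree_le (d : ℕ) :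
    2 * Nat.card {s : Fin 2 →₀ ℕ | (s.sum fun _ e => e) ≤ d} = (d + 1) * (d + 2) := by
  have hcard : Nat.card {s : Fin 2 →₀ ℕ | (s.sum fun _ e => e) ≤ d} =
      ((Finset.range (d + 1)).sigma fun i => Finset.HasAntidiagonal.antidiagonal i).card := by
    rw [← Nat.card_eq_finsetCard]
    refine Nat.card_congr
      { toFun := fun s => ⟨⟨s.1 0 + s.1 1, s.1 0, s.1 1⟩, ?_⟩
        invFun := fun t => ⟨Finsupp.equivFunOnFinite.symm ![t.1.2.1, t.1.2.2], ?_⟩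
        left_inv := ?_
        right_inv := ?_ }
    · have := s.2
      rw [Set.mem_ofPred_eq, Finsupp.sum_fintype _ _ (fun _ => rfl), Fin.sum_univ_two] at this
      simp only [Finset.mem_sigma, Finset.mem_range, Finset.HasAntidiagonal.mem_antidiagonal, and_true]
      omega
    · have ht := Finset.mem_sigma.mp t.2
      rw [Finset.mem_range, Finset.HasAntidiagonal.mem_antidiagonal] at ht
      rw [Set.mem_ofPred_eq, Finsupp.sum_fintype _ _ (fun _ => rfl), Fin.sum_univ_two]
      change t.1.2.1 + t.1.2.2 ≤ d
      omega
    · rintro ⟨s, hs⟩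
      ext i
      fin_cases i <;> rfl
    · rintro ⟨⟨i, a, b⟩, ht⟩
      obtain rfl : a + b = i := Finset.HasAntidiagonal.mem_antidiagonal.mp (Finset.mem_sigma.mp ht).2
      rfl
  rw [hcard, Finset.card_sigma]
  simp only [Finset.Nat.card_antidiagonal]
  clear hcard
  induction d with
  | zero => simp
  | succ d ih => rw [Finset.sum_range_succ, mul_add, ih]; ring

theorem two_mul_finrank_restrictTotalDegree (d : ℕ) :
    2 * finrank K (restrictTotalDegree (Fin 2) K d) = (d + 1) * (d + 2) := by
  rw [← two_mul_card_degree_le, restrictTotalDegree,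
    finrank_eq_nat_card_basis (basisRestrictSupport K _)]

theorem exists_eval_eq_zero_and_ne_zero {p q : K × K} (h : p ≠ q) :
    ∃ l : MvPolynomial (Fin 2) K, eval ![q.1, q.2] l = 0 ∧ eval ![p.1, p.2] l ≠ 0 := by
  by_cases h1 : p.1 = q.1
  · have h2 : p.2 ≠ q.2 := fun h2 => h (Prod.ext h1 h2)
    exact ⟨X 1 - C q.2, by simp, by simpa [sub_eq_zero] using h2⟩
  · exact ⟨X 0 - C q.1, by simp, by simpa [sub_eq_zero] using h1⟩

/-- Evaluation of bivariate polynomials at the points of a finite set. -/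
noncomputable def evalOn (S : Finset (K × K)) : MvPolynomial (Fin 2) K →ₗ[K] S → K :=
  LinearMap.pi fun p => (aeval ![p.1.1, p.1.2]).toLinearMap

@[simp]
theorem evalOn_apply (S : Finset (K × K)) (f : MvPolynomial (Fin 2) K) (p : S) :
    evalOn S f p = eval ![p.1.1, p.1.2] f := by
  simp [evalOn]

theorem evalOn_surjective (S : Finset (K × K)) : Function.Surjective (evalOn S) := by
  classical
  choose! l hl using fun (p q : K × K) (h : p ≠ q) => exists_eval_eq_zero_and_ne_zero h
  rw [← LinearMap.range_eq_top, eq_top_iff, ← (Pi.basisFun K S).span_eq, Submodule.span_le]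
  rintro _ ⟨p, rfl⟩
  let P : MvPolynomial (Fin 2) K := ∏ q ∈ S.erase p.1, l p.1 q
  have hP : eval ![p.1.1, p.1.2] P ≠ 0 := by
    rw [eval_prod]
    exact Finset.prod_ne_zero_iff.mpr fun q hq => (hl _ _ (Finset.ne_of_mem_erase hq).symm).2
  refine ⟨C (eval ![p.1.1, p.1.2] P)⁻¹ * P, ?_⟩
  ext q
  rw [evalOn_apply, map_mul, eval_C, Pi.basisFun_apply]
  by_cases hq : q = p
  · subst hq
    simp [hP]
  · have hq' : q.1 ≠ p.1 := fun h => hq (Subtype.ext h)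
    have hPq : eval ![q.1.1, q.1.2] P = 0 := by
      rw [eval_prod]
      exact Finset.prod_eq_zero (Finset.mem_erase.mpr ⟨hq', q.2⟩) (hl _ _ hq'.symm).1
    rw [Pi.single_eq_of_ne hq, hPq, mul_zero]

theorem exists_restrictTotalDegree_le_map_evalOn_eq_top (S : Finset (K × K)) :
    ∃ d₀, ∀ d, d₀ ≤ d → (restrictTotalDegree (Fin 2) K d).map (evalOn S) = ⊤ := by
  choose P hP using fun p : S => evalOn_surjective S (Pi.basisFun K S p)
  refine ⟨Finset.univ.sup fun p => (P p).totalDegree, fun d hd => ?_⟩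
  rw [eq_top_iff, ← (Pi.basisFun K S).span_eq, Submodule.span_le]
  rintro _ ⟨p, rfl⟩
  refine ⟨P p, ?_, hP p⟩
  exact (mem_restrictTotalDegree _ _ _).mpr
    ((Finset.le_sup (f := fun p => (P p).totalDegree) (Finset.mem_univ p)).trans hd)

/-- Multiplication by `f` as a map from polynomials of degree at most `a` to those of degree at
most `b`. -/
noncomputable def mulRestrict (f : MvPolynomial (Fin 2) K) {a b : ℕ} (h : f.totalDegree + a ≤ b) :
    restrictTotalDegree (Fin 2) K a →ₗ[K] restrictTotalDegree (Fin 2) K b :=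
  (LinearMap.mulLeft K f).restrict fun u hu => by
    rw [mem_restrictTotalDegree] at hu ⊢
    exact (totalDegree_mul f u).trans (by omega)

theorem card_le_of_isRelPrime {f g : MvPolynomial (Fin 2) K} (hg : g ≠ 0)
    (hfg : IsRelPrime f g) (S : Finset (K × K))
    (hS : ∀ p ∈ S, eval ![p.1, p.2] f = 0 ∧ eval ![p.1, p.2] g = 0) :
    S.card ≤ f.totalDegree * g.totalDegree := by
  obtain ⟨e, he⟩ := exists_restrictTotalDegree_le_map_evalOn_eq_top S
  set m := f.totalDegree with hm
  set n := g.totalDegree with hn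
  let R (d : ℕ) := restrictTotalDegree (Fin 2) K d
  let ev : R (m + n + e) →ₗ[K] S → K := (evalOn S).domRestrict _
  let φ : R (n + e) × R (m + e) →ₗ[K] R (m + n + e) :=
    (mulRestrict f (by omega)).coprod (mulRestrict g (by omega))
  let ψ : R e →ₗ[K] R (n + e) × R (m + e) :=
    (mulRestrict g (by omega)).prod (-mulRestrict f (by omega))
  have hev : finrank K (LinearMap.range ev) = S.card := by
    rw [LinearMap.range_domRestrict, he _ (by omega), finrank_top]
    simp
  have hφ : LinearMap.range φ ≤ LinearMap.ker ev := by
    rintro _ ⟨⟨u, v⟩, rfl⟩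
    ext p
    change evalOn S (f * u.1 + g * v.1) p = 0
    simp [hS p.1 p.2]
  have hψ : LinearMap.ker φ ≤ LinearMap.range ψ := by
    rintro ⟨u, v⟩ huv
    replace huv : f * u.1 + g * v.1 = 0 := congrArg Subtype.val huv
    obtain ⟨c, hc⟩ : g ∣ u.1 := hfg.symm.dvd_of_dvd_mul_left ⟨-v.1, by linear_combination huv⟩
    have hcv : v.1 = -(f * c) := mul_left_cancel₀ hg (by linear_combination huv - f * hc)
    have hcR : c ∈ R e := by
      rw [mem_restrictTotalDegree]
      rcases eq_or_ne c 0 with rfl | hc0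
      · simp
      · have hu := (mem_restrictTotalDegree _ _ _).mp u.2
        rw [hc, totalDegree_mul_of_isDomain hg hc0] at hu
        omega
    exact ⟨⟨c, hcR⟩, Prod.ext (Subtype.ext hc.symm) (Subtype.ext hcv.symm)⟩
  have h1 := LinearMap.finrank_range_add_finrank_ker ev
  have h2 := LinearMap.finrank_range_add_finrank_ker φ
  have h3 := Submodule.finrank_mono hφ
  have h4 := (Submodule.finrank_mono hψ).trans (LinearMap.finrank_range_le ψ)
  rw [finrank_prod] at h2
  have d1 := two_mul_finrank_restrictTotalDegree (K := K) (m + n + e)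
  have d2 := two_mul_finrank_restrictTotalDegree (K := K) (n + e)
  have d3 := two_mul_finrank_restrictTotalDegree (K := K) (m + e)
  have d4 := two_mul_finrank_restrictTotalDegree (K := K) e
  nlinarith

theorem isRelPrime_of_forall_totalDegree {f g : MvPolynomial (Fin 2) K} (hf : f ≠ 0)
    (h : ¬ ∃ h : MvPolynomial (Fin 2) K, 1 ≤ h.totalDegree ∧ h ∣ f ∧ h ∣ g) :
    IsRelPrime f g := by
  intro d hdf hdg
  have hd : d.totalDegree = 0 := by
    by_contra hd
    exact h ⟨d, Nat.one_le_iff_ne_zero.mpr hd, hdf, hdg⟩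
  rw [isUnit_iff_totalDegree_of_isReduced]
  refine ⟨?_, hd⟩
  rw [totalDegree_eq_zero_iff_eq_C] at hd
  rw [isUnit_iff_ne_zero]
  intro h0
  rw [hd, h0, C_0, zero_dvd_iff] at hdf
  exact hf hdf

end

/-- Bezout's theorem (plane-curve form): two nonzero polynomials in `ℂ[x,y]` of total
degrees `m` and `n` with no common non-constant factor have at most `m·n` common zeros. -/
theorem bezout_plane_curves (m n : ℕ) (f g : MvPolynomial (Fin 2) ℂ)
    (hf : f ≠ 0) (hg : g ≠ 0)
    (hm : f.totalDegree = m) (hn : g.totalDegree = n)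
    (hcoprime : ¬ ∃ h : MvPolynomial (Fin 2) ℂ, 1 ≤ h.totalDegree ∧ h ∣ f ∧ h ∣ g) :
    ({p : ℂ × ℂ | MvPolynomial.eval ![p.1, p.2] f = 0 ∧
        MvPolynomial.eval ![p.1, p.2] g = 0}).Finite ∧
    ({p : ℂ × ℂ | MvPolynomial.eval ![p.1, p.2] f = 0 ∧
        MvPolynomial.eval ![p.1, p.2] g = 0}).ncard ≤ m * n := by
  subst hm hn
  have hcard := card_le_of_isRelPrime hg (isRelPrime_of_forall_totalDegree hf hcoprime)
  have hfin : {p : ℂ × ℂ | eval ![p.1, p.2] f = 0 ∧ eval ![p.1, p.2] g = 0}.Finite := by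
    by_contra hinf
    obtain ⟨S, hS, hSc⟩ := Set.Infinite.exists_subset_card_eq hinf
      (f.totalDegree * g.totalDegree + 1)
    have := hcard S hS
    omega
  refine ⟨hfin, ?_⟩
  rw [Set.ncard_eq_toFinset_card _ hfin]
  exact hcard _ fun p hp => hfin.mem_toFinset.mp hp
end

section
/- (Y. Stein's theorem.) Let f(x,y) ∈ ℂ[x,y] be a non-constant polynomial of total degree k which is not composite. Then the set σ(f) = {λ ∈ ℂ : f(x,y) − λ is reducible in ℂ[x,y]} is finite and has cardinality |σ(f)| < k. -/
/-- `f(x,y) ∈ ℂ[x,y]` is composite if `f = Q(g)` with `Q ∈ ℂ[t]` of degree `≥ 2`. -/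
def IsCompositeC (f : MvPolynomial (Fin 2) ℂ) : Prop :=
  ∃ (Q : Polynomial ℂ) (g : MvPolynomial (Fin 2) ℂ), 2 ≤ Q.natDegree ∧
    ∀ x y : ℂ, MvPolynomial.eval ![x, y] f = Q.eval (MvPolynomial.eval ![x, y] g)

section

open Polynomial

theorem WithZero.log_finset_prod {ι : Type*} (s : Finset ι) (f : ι → WithZero (Multiplicative ℤ))
    (hf : ∀ i ∈ s, f i ≠ 0) :
    WithZero.log (∏ i ∈ s, f i) = ∑ i ∈ s, WithZero.log (f i) := by
  classical
  induction s using Finset.induction_on with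
  | empty => simp
  | insert i s hi ih =>
    rw [Finset.prod_insert hi, Finset.sum_insert hi, WithZero.log_mul (hf i (by simp)),
      ih fun j hj => hf j (by simp [hj])]
    exact Finset.prod_ne_zero_iff.2 fun j hj => hf j (by simp [hj])

/-- In a finite separable extension `F` of the fraction field `E` of a discrete valuation ring `O`,
more than `[F : E]` nonzero elements admit a nontrivial multiplicative combination which is a unit
of the integral closure of `O`. -/
theorem exists_zpow_prod_isIntegral {O E F ι : Type*} [CommRing O] [IsDomain O]
    [IsDiscreteValuationRing O] [Field E] [Algebra O E] [IsFractionRing O E] [Field F]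
    [Algebra E F] [Algebra O F] [IsScalarTower O E F] [FiniteDimensional E F]
    [Algebra.IsSeparable E F] [Fintype ι] (u : ι → F) (hu : ∀ i, u i ≠ 0)
    (hcard : Module.finrank E F < Fintype.card ι) :
    ∃ a : ι → ℤ, a ≠ 0 ∧ IsIntegral O (∏ i, u i ^ a i) ∧ IsIntegral O (∏ i, u i ^ a i)⁻¹ := by
  classical
  let S := integralClosure O F
  have : IsDedekindDomain S := integralClosure.isDedekindDomain O E F
  have : IsFractionRing S F := integralClosure.isFractionRing_of_finite_extension E F
  have : Module.Finite O S := IsIntegralClosure.finite O E F S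
  have : Module.IsTorsionFree O F := Module.IsTorsionFree.trans_faithfulSMul O E F
  have : Module.Free O S := IsIntegralClosure.module_free O E F S
  let p := IsLocalRing.maximalIdeal O
  let g : IsDedekindDomain.HeightOneSpectrum S → p.primesOver S := fun v =>
    ⟨v.asIdeal, v.isPrime, ⟨by
      have := v.isMaximal
      exact (IsLocalRing.eq_maximalIdeal
        (Ideal.isMaximal_comap_of_isIntegral_of_isMaximal (R := O) v.asIdeal)).symm⟩⟩
  have hg : Function.Injective g := fun v w h =>
    IsDedekindDomain.HeightOneSpectrum.ext (congrArg Subtype.val h)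
  have : Fintype (p.primesOver S) := Fintype.ofFinite _
  have : Fintype (IsDedekindDomain.HeightOneSpectrum S) := Fintype.ofInjective g hg
  have hc : Fintype.card (IsDedekindDomain.HeightOneSpectrum S) < Fintype.card ι := by
    refine lt_of_le_of_lt ((Fintype.card_le_of_injective g hg).trans ?_) hcard
    rw [← IsIntegralClosure.rank O E F S, ← p.sum_ramification_inertia_eq_finrank S,
      Fintype.card_eq_sum_ones]
    refine Finset.sum_le_sum fun q _ => ?_
    have := q.2.1
    exact Nat.mul_pos (Ideal.ramificationIdx_pos _ _) (Ideal.inertiaDeg_pos _ _)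
  let w : ι → IsDedekindDomain.HeightOneSpectrum S → ℤ := fun i v =>
    WithZero.log (v.valuation F (u i))
  have hw : ¬ LinearIndependent ℤ w := fun h => by
    have := h.fintype_card_le_finrank
    rw [Module.finrank_fintype_fun_eq_card] at this
    omega
  obtain ⟨a, ha, i, hi⟩ := Fintype.not_linearIndependent_iff.1 hw
  have hval (v : IsDedekindDomain.HeightOneSpectrum S) :
      v.valuation F (∏ i, u i ^ a i) = 1 := by
    have h0 (j : ι) : v.valuation F (u j ^ a j) ≠ 0 := by
      rw [Ne, Valuation.zero_iff]
      exact fun hj => hu j (eq_zero_of_zpow_eq_zero hj)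
    have := congrFun ha v
    simp only [Finset.sum_apply, Pi.smul_apply, smul_eq_mul, Pi.zero_apply, w] at this
    rw [map_prod, ← WithZero.exp_log (Finset.prod_ne_zero_iff.2 fun j _ => h0 j),
      ← WithZero.exp_zero, WithZero.exp_inj, WithZero.log_finset_prod _ _ fun j _ => h0 j, ← this]
    simp [map_zpow₀, WithZero.log_zpow]
  refine ⟨a, fun h => hi (congrFun h i), ?_, ?_⟩
  · obtain ⟨s, hs⟩ := IsDedekindDomain.HeightOneSpectrum.mem_integers_of_valuation_le_one (R := S) F
      (∏ i, u i ^ a i) (fun v => (hval v).le)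
    rw [← hs]; exact s.2
  · obtain ⟨s, hs⟩ := IsDedekindDomain.HeightOneSpectrum.mem_integers_of_valuation_le_one (R := S) F
      (∏ i, u i ^ a i)⁻¹ (fun v => by rw [map_inv₀, hval v, inv_one])
    rw [← hs]; exact s.2

theorem natDegree_eq_zero_of_mem_infty {K : Type*} [Field K] [DecidableEq (RatFunc K)] (p : K[X])
    (h : algebraMap K[X] (RatFunc K) p ∈ (RatFunc.inftyValuation K).valuationSubring) :
    p.natDegree = 0 := by
  by_cases hp : p = 0
  · simp [hp]
  rw [Valuation.mem_valuationSubring_iff, RatFunc.inftyValuation_apply,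
    RatFunc.inftyValuation.polynomial _ hp, ← WithZero.exp_zero, WithZero.exp_le_exp] at h
  omega

theorem isIntegral_of_isIntegral_infty {K F : Type*} [Field K] [DecidableEq (RatFunc K)]
    [Field F] [Algebra (RatFunc K) F]
    [Algebra K[X] F] [IsScalarTower K[X] (RatFunc K) F] [Algebra K F] [IsScalarTower K K[X] F]
    {w : F} (h1 : IsIntegral K[X] w)
    (h2 : IsIntegral (RatFunc.inftyValuation K).valuationSubring w) : IsIntegral K w := by
  have e1 := minpoly.isIntegrallyClosed_eq_field_fractions' (RatFunc K) h1
  have e2 := minpoly.isIntegrallyClosed_eq_field_fractions' (RatFunc K) h2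
  have hc (i : ℕ) : ((minpoly K[X] w).coeff i).natDegree = 0 := by
    apply natDegree_eq_zero_of_mem_infty
    rw [← coeff_map, ← e1, e2, coeff_map]
    exact Subtype.property _
  obtain ⟨q, hq, -, hm⟩ := lifts_and_natDegree_eq_and_monic (f := (C : K →+* K[X]))
    (p := minpoly K[X] w) (by
      rw [lifts_iff_coeff_lifts]
      exact fun i => ⟨_, (eq_C_of_natDegree_eq_zero (hc i)).symm⟩) (minpoly.monic h1)
  refine ⟨q, hm, ?_⟩
  rw [IsScalarTower.algebraMap_eq K K[X] F, ← eval₂_map]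
  change eval₂ _ _ (q.map C) = 0
  rw [hq]
  exact minpoly.aeval _ _

/-- In a finite extension `F` of `K(x)`, at least `[F : K(x)]` units of the integral closure of
`K[x]` are multiplicatively dependent modulo constants. -/
theorem exists_zpow_prod_isIntegral_const {K F ι : Type*} [Field K] [CharZero K]
    [Field F] [Algebra (RatFunc K) F] [FiniteDimensional (RatFunc K) F]
    [Algebra K[X] F] [IsScalarTower K[X] (RatFunc K) F] [Algebra K F] [IsScalarTower K K[X] F]
    [Fintype ι] (u : ι → F) (hu : ∀ i, u i ≠ 0) (h1 : ∀ i, IsIntegral K[X] (u i))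
    (h2 : ∀ i, IsIntegral K[X] (u i)⁻¹)
    (hcard : Module.finrank (RatFunc K) F ≤ Fintype.card ι) :
    ∃ a : ι → ℤ, a ≠ 0 ∧ IsIntegral K (∏ i, u i ^ a i) := by
  classical
  let O := (RatFunc.inftyValuation K).valuationSubring
  let x : F := algebraMap K[X] F X
  have hx : x = algebraMap (RatFunc K) F RatFunc.X := by
    rw [← RatFunc.algebraMap_X, ← IsScalarTower.algebraMap_apply]
  have hx0 : x ≠ 0 := by rw [hx]; simpa using RatFunc.X_ne_zero
  have hint (a : ι → ℤ) : IsIntegral K[X] (∏ i, u i ^ a i) := by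
    refine IsIntegral.prod _ fun i _ => ?_
    obtain ⟨n, hn | hn⟩ := (a i).eq_nat_or_neg
    · rw [hn, zpow_natCast]; exact (h1 i).pow n
    · rw [hn, zpow_neg, zpow_natCast, ← inv_pow]; exact (h2 i).pow n
  have hxO : IsIntegral O x⁻¹ := by
    have : RatFunc.X⁻¹ ∈ O := by
      rw [Valuation.mem_valuationSubring_iff, map_inv₀, RatFunc.inftyValuation.X,
        ← WithZero.exp_neg, ← WithZero.exp_zero, WithZero.exp_le_exp]
      norm_num
    have h := isIntegral_algebraMap (R := O) (A := F) (x := ⟨_, this⟩)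
    rwa [IsScalarTower.algebraMap_apply O (RatFunc K) F,
      show algebraMap O (RatFunc K) ⟨_, this⟩ = RatFunc.X⁻¹ from rfl, map_inv₀, ← hx] at h
  obtain ⟨a, ha0, ha1, ha2⟩ := exists_zpow_prod_isIntegral (O := O) (E := RatFunc K)
    (fun o : Option ι => o.elim x u) (by rintro (_ | i); exacts [hx0, hu i])
    (by rw [Fintype.card_option]; omega)
  simp only [Fintype.prod_option, Option.elim] at ha1 ha2
  -- reduce to the case of a nonnegative exponent of `x`
  obtain ⟨b, c, hbc, hb⟩ : ∃ (b : ι → ℤ) (c : ℕ), (b ≠ 0 ∨ c ≠ 0) ∧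
      IsIntegral O (x ^ c * ∏ i, u i ^ b i) := by
    have hne : (fun i => a (some i)) ≠ 0 ∨ (a none).natAbs ≠ 0 := by
      by_contra! h
      exact ha0 (funext fun o => by cases o; exacts [by simpa using h.2, congrFun h.1 _])
    rcases le_total 0 (a none) with h | h
    · refine ⟨_, (a none).natAbs, hne, ?_⟩
      rwa [← zpow_natCast, Int.natAbs_of_nonneg h]
    · refine ⟨fun i => - a (some i), (a none).natAbs, ?_, ?_⟩
      rotate_left
      · rw [← zpow_natCast, Int.ofNat_natAbs_of_nonpos h]
        simpa [mul_inv, mul_comm] using ha2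
      · simpa [funext_iff] using hne
  by_cases hb0 : b = 0
  · exfalso
    have hc : c ≠ 0 := hbc.resolve_left (by simp [hb0])
    simp only [hb0, Pi.zero_apply, zpow_zero, Finset.prod_const_one, mul_one, hx, ← map_pow] at hb
    rw [isIntegral_algebraMap_iff (algebraMap (RatFunc K) F).injective] at hb
    obtain ⟨y, hy⟩ := IsIntegrallyClosed.isIntegral_iff.1 hb
    have := natDegree_eq_zero_of_mem_infty (K := K) (X ^ c) (by
      rw [map_pow, RatFunc.algebraMap_X, ← hy]; exact y.2)
    simp at this
    exact hc this
  · refine ⟨b, hb0, isIntegral_of_isIntegral_infty (hint b) ?_⟩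
    have := (hxO.pow c).mul hb
    rwa [← mul_assoc, ← mul_pow, inv_mul_cancel₀ hx0, one_pow, one_mul] at this

theorem IsIntegrallyClosed.exists_algebraMap_eq_of_mul_eq {R S : Type*} [CommRing R] [IsDomain R]
    [IsIntegrallyClosed R] [CommRing S] [IsDomain S] [Algebra R S] [FaithfulSMul R S]
    {s : S} (hs : IsIntegral R s) {r r' : R} (hr : r ≠ 0)
    (h : algebraMap R S r * s = algebraMap R S r') : ∃ t, algebraMap R S t = s := by
  let L := FractionRing S
  let : Algebra (FractionRing R) L := FractionRing.liftAlgebra R L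
  have hr0 : algebraMap R L r ≠ 0 := by simpa using hr
  have h1 : algebraMap S L s = algebraMap (FractionRing R) L
      (algebraMap R _ r' / algebraMap R _ r) := by
    rw [map_div₀, ← IsScalarTower.algebraMap_apply, ← IsScalarTower.algebraMap_apply,
      eq_div_iff hr0, IsScalarTower.algebraMap_apply R S L r',
      IsScalarTower.algebraMap_apply R S L r, ← map_mul, ← h, mul_comm]
  have h2 : IsIntegral R (algebraMap S L s) := hs.algebraMap
  rw [h1, isIntegral_algebraMap_iff (algebraMap (FractionRing R) L).injective] at h2
  obtain ⟨t, ht⟩ := IsIntegrallyClosed.isIntegral_iff.1 h2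
  refine ⟨t, IsFractionRing.injective S L ?_⟩
  rw [h1, ← ht, ← IsScalarTower.algebraMap_apply, ← IsScalarTower.algebraMap_apply]

theorem Polynomial.Bivariate.coeff_coeff_swap {R : Type*} [CommRing R] (p : R[X][X]) (i j : ℕ) :
    ((swap p).coeff i).coeff j = (p.coeff j).coeff i := by
  induction p using Polynomial.induction_on' with
  | add p q hp hq => simp [hp, hq]
  | monomial n a =>
    induction a using Polynomial.induction_on' with
    | add p q hp hq => simp only [map_add, coeff_add, hp, hq]
    | monomial m a =>
      rw [swap_monomial_monomial]
      simp only [coeff_monomial]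
      split_ifs <;> simp_all [coeff_monomial]

/-- A normal `k`-subalgebra of `k[X]` over which `k[X]` is integral is generated by one element. -/
theorem exists_adjoin_singleton_eq_top {k R : Type*} [Field k] [CommRing R] [IsDomain R]
    [IsIntegrallyClosed R] [Algebra k R] [Algebra R k[X]] [IsScalarTower k R k[X]]
    [FaithfulSMul R k[X]] [Algebra.IsIntegral R k[X]] :
    ∃ h : R, Algebra.adjoin k {h} = ⊤ := by
  classical
  have hinj : Function.Injective (algebraMap R k[X]) := FaithfulSMul.algebraMap_injective R k[X]
  have hX : IsIntegral R (X : k[X]) := Algebra.IsIntegral.isIntegral _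
  let φ := algebraMap R k[X]
  have hφ (c : k) : φ (algebraMap k R c) = C c := (IsScalarTower.algebraMap_apply k R k[X] c).symm
  set m := minpoly R (X : k[X]) with hm
  obtain ⟨j, hj⟩ : ∃ j, (φ (m.coeff j)).natDegree ≠ 0 := by
    by_contra! hcon
    obtain ⟨q, hq, -, hqm⟩ := lifts_and_natDegree_eq_and_monic (f := (C : k →+* k[X]))
      (p := m.map φ) (by
        rw [lifts_iff_coeff_lifts]
        intro i
        rw [coeff_map]
        exact ⟨_, (eq_C_of_natDegree_eq_zero (hcon i)).symm⟩) ((minpoly.monic hX).map φ)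
    have h0 := minpoly.aeval R (X : k[X])
    rw [aeval_def, ← eval_map, ← hm] at h0
    change (m.map φ).eval X = 0 at h0
    rw [← hq, eval_map, eval₂_C_X] at h0
    exact hqm.ne_zero h0
  obtain ⟨h, hh0, hmin⟩ : ∃ h : R, (φ h).natDegree ≠ 0 ∧
      ∀ b : R, (φ b).natDegree ≠ 0 → (φ h).natDegree ≤ (φ b).natDegree := by
    have hex : ∃ n : ℕ, n ≠ 0 ∧ ∃ h : R, (φ h).natDegree = n := ⟨_, hj, _, rfl⟩
    obtain ⟨hn, h, hh⟩ := Nat.find_spec hex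
    exact ⟨h, hh ▸ hn, fun b hb => hh ▸ Nat.find_min' hex ⟨hb, b, rfl⟩⟩
  let H : R → k[X][X] := fun b => (φ b).map C - C (φ b)
  have hdvd (b : R) : m.map φ ∣ H b := by
    have : m ∣ (φ b).map (algebraMap k R) - C b := by
      refine minpoly.isIntegrallyClosed_dvd hX ?_
      simp [aeval_map_algebraMap, φ]
    have := Polynomial.map_dvd φ this
    rwa [Polynomial.map_sub, map_C, Polynomial.map_map, RingHom.ext (f := φ.comp _) hφ] at this
  have hswap (b : R) : Bivariate.swap (H b) = C (φ b) - (φ b).map C := by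
    simp only [H, map_sub, Bivariate.swap_map_C, Bivariate.swap_C]
  have hassoc : H h ∣ m.map φ := by
    obtain ⟨q, hq⟩ := hdvd h
    have hs := congrArg Bivariate.swap hq
    rw [hswap, map_mul] at hs
    have hdeg : (C (φ h) - (φ h).map C : k[X][X]).natDegree = (φ h).natDegree := by
      rw [← neg_sub, natDegree_neg, natDegree_sub_C, natDegree_map_eq_of_injective (C_injective)]
    have hne : (C (φ h) - (φ h).map C : k[X][X]) ≠ 0 := by
      intro h0; rw [h0] at hdeg; exact hh0 hdeg.symm
    have hne' := hs ▸ hne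
    have hd1 : (φ h).natDegree ≤ (Bivariate.swap (m.map φ)).natDegree := by
      refine (hmin _ hj).trans (le_natDegree_of_ne_zero fun h0 => ?_)
      have := congrArg (coeff · j) h0
      rw [Bivariate.coeff_coeff_swap, coeff_map, coeff_natDegree, coeff_zero,
        leadingCoeff_eq_zero] at this
      exact hj (by rw [this, natDegree_zero])
    have hd2 := natDegree_mul (left_ne_zero_of_mul hne') (right_ne_zero_of_mul hne')
    rw [← hs, hdeg] at hd2
    have hQ := eq_C_of_natDegree_eq_zero (p := Bivariate.swap q) (by omega)
    set q0 := (Bivariate.swap q).coeff 0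
    have hl := congrArg leadingCoeff hs
    rw [hQ, leadingCoeff_mul, leadingCoeff_C] at hl
    have hl2 : leadingCoeff (C (φ h) - (φ h).map C : k[X][X]) = C (-(φ h).leadingCoeff) := by
      rw [leadingCoeff, hdeg, coeff_sub, coeff_C, if_neg hh0, coeff_map, coeff_natDegree]
      simp
    have hu : IsUnit q0 := by
      refine isUnit_of_dvd_unit (Dvd.intro_left _ hl.symm) ?_
      rw [hl2, isUnit_C]
      have : φ h ≠ 0 := fun h0 => hh0 (by simp [h0])
      simpa using this
    have huq : IsUnit q := by
      have := hu.map (C : k[X] →+* k[X][X])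
      rw [← hQ] at this
      simpa using this.map (Bivariate.swap (R := k))
    rw [hq]
    exact (associated_mul_unit_left _ _ huq).dvd
  refine ⟨h, ?_⟩
  rw [eq_top_iff]
  rintro b -
  induction hn : (φ b).natDegree using Nat.strong_induction_on generalizing b with
  | _ n ih =>
  by_cases hn0 : n = 0
  · rw [hn0] at hn
    have : b = algebraMap k R ((φ b).coeff 0) := by
      apply hinj
      change φ b = φ _
      rw [hφ, ← eq_C_of_natDegree_eq_zero hn]
    rw [this]
    exact Subalgebra.algebraMap_mem _ _
  have h1 := Polynomial.map_dvd (evalRingHom (0 : k)) (hassoc.trans (hdvd b))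
  have hev (b : R) : (H b).map (evalRingHom (0 : k)) = φ (b - algebraMap k R ((φ b).eval 0)) := by
    simp only [H, Polynomial.map_sub, Polynomial.map_map, map_C, map_sub, hφ]
    congr 1
    ext; simp
  rw [hev, hev] at h1
  obtain ⟨s, hs⟩ := h1
  have hdeg (b : R) : (φ (b - algebraMap k R ((φ b).eval 0))).natDegree = (φ b).natDegree := by
    rw [map_sub, hφ, natDegree_sub_C]
  obtain ⟨t, rfl⟩ := IsIntegrallyClosed.exists_algebraMap_eq_of_mul_eq (R := R)
    (Algebra.IsIntegral.isIntegral s) (r := h - algebraMap k R ((φ h).eval 0)) (by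
      intro h0
      have := hdeg h
      rw [h0] at this
      simp at this
      exact hh0 this.symm) hs.symm
  rw [← map_mul] at hs
  have hb := hinj hs
  rw [sub_eq_iff_eq_add] at hb
  have ht : (φ t).natDegree < n := by
    have h1 := hdeg b
    have hbn : φ (b - algebraMap k R ((φ b).eval 0)) ≠ 0 := by
      intro h0
      rw [h0] at h1
      exact hn0 (hn ▸ h1.symm)
    rw [hs, map_mul] at hbn
    rw [hs, map_mul, natDegree_mul (left_ne_zero_of_mul hbn) (right_ne_zero_of_mul hbn), hdeg] at h1
    omega
  rw [hb]
  exact add_mem (mul_mem (sub_mem (Algebra.self_mem_adjoin_singleton _ _)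
    (Subalgebra.algebraMap_mem _ _)) (ih _ ht rfl)) (Subalgebra.algebraMap_mem _ _)

theorem isIntegrallyClosed_integralClosure {A R : Type*} [CommRing A] [CommRing R] [IsDomain R]
    [IsIntegrallyClosed R] [Algebra A R] : IsIntegrallyClosed (integralClosure A R) := by
  let B := integralClosure A R
  let : Algebra (FractionRing B) (FractionRing R) := FractionRing.liftAlgebra B (FractionRing R)
  rw [isIntegrallyClosed_iff (FractionRing B)]
  intro x hx
  have h1 : IsIntegral B (algebraMap _ (FractionRing R) x) := hx.algebraMap
  obtain ⟨r, hr⟩ := IsIntegrallyClosed.isIntegral_iff.1 (h1.tower_top (A := R))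
  rw [← hr, isIntegral_algebraMap_iff (IsFractionRing.injective R _)] at h1
  obtain ⟨y, hy⟩ := IsIntegrallyClosedIn.isIntegral_iff.1 h1
  refine ⟨y, (algebraMap (FractionRing B) (FractionRing R)).injective ?_⟩
  rw [← hr, ← hy, ← IsScalarTower.algebraMap_apply, ← IsScalarTower.algebraMap_apply]

/-- If the monic polynomial `f` is not composite, then `k[f]` is integrally closed in `k[X][X]`. -/
theorem exists_eq_aeval_of_isIntegral {k A : Type*} [Field k] [CommRing A] [Algebra k A]
    [Algebra A k[X][X]] [IsScalarTower k A k[X][X]] {f₀ : A} (hf₀ : Algebra.adjoin k {f₀} = ⊤)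
    {f : k[X][X]} (hff : algebraMap A k[X][X] f₀ = f) (hf : f.Monic) (hdeg : f.natDegree ≠ 0)
    (hnc : ∀ (Q : k[X]) (g : k[X][X]), f = aeval g Q → Q.natDegree ≤ 1)
    {P : k[X][X]} (hP : IsIntegral A P) : ∃ p : k[X], P = aeval f p := by
  let B := integralClosure A k[X][X]
  let : CommRing B := (integralClosure A k[X][X]).toCommRing
  have : IsIntegrallyClosed B := isIntegrallyClosed_integralClosure
  let ψ : k[X][X] →ₐ[k] k[X] := mapAlgHom (aeval (0 : k))
  let : Algebra B k[X] := (ψ.toRingHom.comp (algebraMap B k[X][X])).toAlgebra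
  have hB (b : B) : algebraMap B k[X] b = ψ b := rfl
  have : IsScalarTower k B k[X] := IsScalarTower.of_algebraMap_eq fun c => by
    rw [hB]
    exact (ψ.commutes c).symm
  have hψf : (ψ f).Monic := hf.map _
  have hψd : (ψ f).natDegree = f.natDegree := hf.natDegree_map _
  let f' : B := ⟨f, hff ▸ isIntegral_algebraMap⟩
  have hmonic : ((ψ f).map (algebraMap k B) - C f').Monic := by
    refine (hψf.map _).sub_of_left ?_
    refine lt_of_le_of_lt degree_C_le ?_
    rw [hψf.degree_map, ← natDegree_pos_iff_degree_pos]
    omega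
  have hX : IsIntegral B (X : k[X]) := by
    refine ⟨_, hmonic, ?_⟩
    rw [eval₂_sub, eval₂_C, eval₂_map, ← IsScalarTower.algebraMap_eq, hB]
    change eval₂ C X (ψ f) - ψ f = 0
    rw [eval₂_C_X, sub_self]
  have : Algebra.IsIntegral B k[X] := ⟨fun p => by
    induction p using Polynomial.induction_on' with
    | add p q hp hq => exact hp.add hq
    | monomial n a =>
      rw [← C_mul_X_pow_eq_monomial]
      refine IsIntegral.mul ?_ (hX.pow n)
      have : (C a : k[X]) = algebraMap B k[X] (algebraMap k B a) := by
        rw [← IsScalarTower.algebraMap_apply]; rfl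
      rw [this]
      exact isIntegral_algebraMap⟩
  have : FaithfulSMul B k[X] := by
    rw [faithfulSMul_iff_algebraMap_injective, injective_iff_map_eq_zero]
    intro b hb
    by_contra hb0
    have hbi : IsIntegral A (b : k[X][X]) := b.2
    have : Nontrivial A := (algebraMap A k[X][X]).domain_nontrivial
    obtain ⟨a, ha0, ha⟩ := hbi.isAlgebraic.exists_nonzero_dvd
      (mem_nonZeroDivisors_of_ne_zero (by simpa using hb0))
    have : a ∈ Algebra.adjoin k {f₀} := hf₀ ▸ Algebra.mem_top
    rw [Algebra.adjoin_singleton_eq_range_aeval] at this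
    obtain ⟨q, rfl⟩ := this
    change b.1 ∣ algebraMap A k[X][X] (aeval f₀ q) at ha
    rw [← aeval_algebraMap_apply, hff] at ha
    have h2 := map_dvd ψ ha
    rw [← hB, hb, zero_dvd_iff, ← aeval_algHom_apply] at h2
    change q.comp (ψ f) = 0 at h2
    have hq : q = 0 := by
      rcases comp_eq_zero_iff.1 h2 with h | ⟨-, h⟩
      · exact h
      · rw [h, natDegree_C] at hψd
        exact absurd hψd.symm hdeg
    simp [hq] at ha0
  obtain ⟨h, hh⟩ := exists_adjoin_singleton_eq_top (k := k) (R := B)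
  have hgen (b : B) : ∃ Q : k[X], (b : k[X][X]) = aeval (h : k[X][X]) Q := by
    have : b ∈ Algebra.adjoin k {h} := hh ▸ Algebra.mem_top
    rw [Algebra.adjoin_singleton_eq_range_aeval] at this
    obtain ⟨Q, hQ⟩ := this
    refine ⟨Q, ?_⟩
    rw [← hQ]
    exact (aeval_algHom_apply (B.val.restrictScalars k) h Q).symm
  obtain ⟨Q, hQ⟩ := hgen f'
  obtain ⟨p, hp⟩ := hgen ⟨P, hP⟩
  have hQ1 := hnc Q _ hQ
  change f = _ at hQ
  change P = _ at hp
  rw [eq_X_add_C_of_natDegree_le_one hQ1] at hQ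
  set a := Q.coeff 1
  set b := Q.coeff 0
  have ha : a ≠ 0 := by
    intro ha
    rw [ha] at hQ
    apply hdeg
    rw [hQ]
    simp
  refine ⟨p.comp (C a⁻¹ * (X - C b)), ?_⟩
  rw [hp, aeval_comp]
  congr 1
  simp only [map_add, map_mul, aeval_C, aeval_X, map_sub] at hQ ⊢
  rw [hQ, add_sub_cancel_right, ← mul_assoc, ← map_mul, inv_mul_cancel₀ ha, map_one, one_mul]

theorem emultiplicity_aeval {k R : Type*} [Field k] [CommRing R] [IsDomain R] [Algebra k R]
    {f π : R} {c : k} (hπ : Prime π) (h : π ∣ f - algebraMap k R c) {p : k[X]} (hp : p ≠ 0) :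
    emultiplicity π (aeval f p) =
      p.rootMultiplicity c * emultiplicity π (f - algebraMap k R c) := by
  obtain ⟨q, hq, hqc⟩ := exists_eq_pow_rootMultiplicity_mul_and_not_dvd p hp c
  have hq0 : ¬ π ∣ aeval f q := by
    intro hd
    have h1 : f - algebraMap k R c ∣ aeval f q - aeval (algebraMap k R c) q := by
      simpa only [eval_map_algebraMap] using
        sub_dvd_eval_sub f (algebraMap k R c) (q.map (algebraMap k R))
    have h2 := (dvd_sub_right hd).1 (h.trans h1)
    rw [aeval_algebraMap_apply] at h2
    refine hπ.not_isUnit (isUnit_of_dvd_unit h2 (IsUnit.map _ ?_))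
    rw [isUnit_iff_ne_zero]
    rwa [dvd_iff_isRoot] at hqc
  conv_lhs => rw [hq]
  rw [map_mul, emultiplicity_mul hπ, map_pow, emultiplicity_pow hπ, emultiplicity_eq_zero.2 hq0,
    add_zero]
  simp

theorem not_dvd_of_dvd_sub {k R : Type*} [Field k] [CommRing R] [Algebra k R]
    {f π : R} {c d : k} (hπ : Prime π) (h : π ∣ f - algebraMap k R c) (hcd : c ≠ d) :
    ¬ π ∣ f - algebraMap k R d := by
  intro h2
  have h3 := dvd_sub h h2
  rw [sub_sub_sub_cancel_left, ← map_sub] at h3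
  exact hπ.not_isUnit (isUnit_of_dvd_unit h3 (IsUnit.map _ (sub_ne_zero.2 hcd.symm).isUnit))

theorem eq_of_aeval_mul_prod_pow_eq {k R ι : Type*} [Field k] [CommRing R] [IsDomain R]
    [UniqueFactorizationMonoid R] [Algebra k R] [Fintype ι] {f : R} {c : ι → k}
    (hc : Function.Injective c) (hf : ∀ i, f ≠ algebraMap k R (c i)) {s t : ι → R}
    (hs : ∀ i, Prime (s i)) (ht : ∀ i, Prime (t i)) (hts : ∀ i, ¬ t i ∣ s i)
    (hsd : ∀ i, s i ∣ f - algebraMap k R (c i)) (htd : ∀ i, t i ∣ f - algebraMap k R (c i))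
    {p q : k[X]} (hp : p ≠ 0) (hq : q ≠ 0) {a b : ι → ℕ}
    (h : aeval f q * ∏ i, s i ^ a i = aeval f p * ∏ i, s i ^ b i) : a = b := by
  classical
  funext i
  have hfin (π : R) (hπ : Prime π) :
      emultiplicity π (f - algebraMap k R (c i)) = multiplicity π (f - algebraMap k R (c i)) :=
    (FiniteMultiplicity.of_prime_left hπ (sub_ne_zero.2 (hf i))).emultiplicity_eq_multiplicity
  have hprod (π : R) (hπ : Prime π) (hd : π ∣ f - algebraMap k R (c i)) (n : ι → ℕ) :
      emultiplicity π (∏ j, s j ^ n j) = n i * emultiplicity π (s i) := by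
    rw [Finset.emultiplicity_prod hπ, Finset.sum_eq_single i]
    · rw [emultiplicity_pow hπ]
    · intro j _ hj
      rw [emultiplicity_pow hπ, emultiplicity_eq_zero.2, mul_zero]
      exact fun h => not_dvd_of_dvd_sub hπ hd (hc.ne hj.symm) (h.trans (hsd j))
    · simp
  have h1 := congrArg (emultiplicity (t i)) h
  have h2 := congrArg (emultiplicity (s i)) h
  rw [emultiplicity_mul (ht i), emultiplicity_mul (ht i), hprod _ (ht i) (htd i),
    hprod _ (ht i) (htd i), emultiplicity_eq_zero.2 (hts i), emultiplicity_aeval (ht i) (htd i) hp,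
    emultiplicity_aeval (ht i) (htd i) hq, hfin _ (ht i)] at h1
  rw [emultiplicity_mul (hs i), emultiplicity_mul (hs i), hprod _ (hs i) (hsd i),
    hprod _ (hs i) (hsd i),
    (FiniteMultiplicity.of_prime_left (hs i) (hs i).ne_zero).emultiplicity_self, emultiplicity_aeval (hs i) (hsd i) hp,
    emultiplicity_aeval (hs i) (hsd i) hq, hfin _ (hs i)] at h2
  norm_cast at h1 h2
  have hpos : multiplicity (t i) (f - algebraMap k R (c i)) ≠ 0 :=
    multiplicity_ne_zero.2 (htd i)
  simp only [mul_zero, add_zero, mul_one] at h1 h2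
  rw [Nat.mul_left_inj hpos] at h1
  rw [h1] at h2
  omega

theorem IntermediateField.adjoin_singleton_eq_top_of_adjoin_pair {K L F : Type*} [Field K]
    [Field L] [Field F] [Algebra K L] [Algebra L F] [Algebra K F] [IsScalarTower K L F]
    {a : L} {y : F} (h : IntermediateField.adjoin K {algebraMap L F a, y} = ⊤) :
    IntermediateField.adjoin L {y} = ⊤ := by
  have hle : IntermediateField.adjoin K {algebraMap L F a, y} ≤
      (IntermediateField.adjoin L {y}).restrictScalars K := by
    rw [IntermediateField.adjoin_le_iff, Set.pair_subset_iff]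
    exact ⟨(IntermediateField.adjoin L {y}).algebraMap_mem a,
      IntermediateField.mem_adjoin_simple_self L y⟩
  rw [h] at hle
  exact eq_top_iff.2 fun z _ => hle IntermediateField.mem_top

theorem exists_zpow_prod_isIntegral_of_adjoin_eq_top {K F ι : Type*} [Field K] [CharZero K]
    [Field F] [Algebra (RatFunc K) F] [Algebra K[X] F] [IsScalarTower K[X] (RatFunc K) F]
    [Algebra K F] [IsScalarTower K K[X] F] [Fintype ι] {y : F}
    (hxy : IntermediateField.adjoin K {algebraMap K[X] F X, y} = ⊤) {P : K[X][X]} (hP : P.Monic)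
    (hPy : aeval y P = 0) (hcard : P.natDegree ≤ Fintype.card ι)
    (u : ι → F) (hu : ∀ i, u i ≠ 0) (h1 : ∀ i, u i ∈ Algebra.adjoin K {algebraMap K[X] F X, y})
    (h2 : ∀ i, (u i)⁻¹ ∈ Algebra.adjoin K {algebraMap K[X] F X, y}) :
    ∃ a : ι → ℤ, a ≠ 0 ∧ IsIntegral K (∏ i, u i ^ a i) := by
  have : IsScalarTower K (RatFunc K) F := IsScalarTower.of_algebraMap_eq fun p => by
    rw [IsScalarTower.algebraMap_apply K K[X] F, IsScalarTower.algebraMap_apply K[X] (RatFunc K) F,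
      ← IsScalarTower.algebraMap_apply K K[X] (RatFunc K)]
  have hyi : IsIntegral K[X] y := ⟨P, hP, hPy⟩
  have hadj : Algebra.adjoin K {algebraMap K[X] F X, y} ≤
      (integralClosure K[X] F).restrictScalars K := by
    rw [Algebra.adjoin_le_iff]
    rintro z (rfl | rfl)
    exacts [isIntegral_algebraMap, hyi]
  have hy : IsIntegral (RatFunc K) y := hyi.tower_top
  have htop : IntermediateField.adjoin (RatFunc K) {y} = ⊤ := by
    rw [IsScalarTower.algebraMap_apply K[X] (RatFunc K) F] at hxy
    exact IntermediateField.adjoin_singleton_eq_top_of_adjoin_pair hxy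
  have hfd : FiniteDimensional (RatFunc K) F := by
    have := IntermediateField.adjoin.finiteDimensional hy
    rw [htop] at this
    exact Module.Finite.equiv IntermediateField.topEquiv.toLinearEquiv
  have hrank : Module.finrank (RatFunc K) F ≤ Fintype.card ι := by
    rw [← IntermediateField.finrank_top', ← htop, IntermediateField.adjoin.finrank hy]
    refine (natDegree_le_of_dvd (minpoly.dvd (RatFunc K) y (p := P.map (algebraMap _ _)) ?_)
      (hP.map _).ne_zero).trans (natDegree_map_le.trans hcard)
    rw [aeval_map_algebraMap, hPy]
  exact exists_zpow_prod_isIntegral_const u hu (fun i => hadj (h1 i)) (fun i => hadj (h2 i)) hrank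

theorem exists_zpow_prod_isIntegral_of_transcendental {K F ι : Type*} [Field K] [CharZero K]
    [Field F] [Algebra K F] [Fintype ι] {x y : F} (hx : Transcendental K x)
    (hxy : IntermediateField.adjoin K {x, y} = ⊤) {P : K[X][X]} (hP : P.Monic)
    (hPxy : eval₂ ((aeval x : K[X] →ₐ[K] F) : K[X] →+* F) y P = 0)
    (hcard : P.natDegree ≤ Fintype.card ι)
    (u : ι → F) (hu : ∀ i, u i ≠ 0) (h1 : ∀ i, u i ∈ Algebra.adjoin K {x, y})
    (h2 : ∀ i, (u i)⁻¹ ∈ Algebra.adjoin K {x, y}) :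
    ∃ a : ι → ℤ, a ≠ 0 ∧ IsIntegral K (∏ i, u i ^ a i) := by
  let : Algebra K[X] F := ((aeval x : K[X] →ₐ[K] F) : K[X] →+* F).toAlgebra
  have hKX (p : K[X]) : algebraMap K[X] F p = aeval x p := rfl
  have : IsScalarTower K K[X] F := IsScalarTower.of_algebraMap_eq fun c => by
    rw [hKX]; exact (AlgHom.commutes _ c).symm
  have hinj : Function.Injective (algebraMap K[X] F) := transcendental_iff_injective.1 hx
  let : Algebra (RatFunc K) F := (IsFractionRing.lift (K := RatFunc K) hinj).toAlgebra
  have : IsScalarTower K[X] (RatFunc K) F := IsScalarTower.of_algebraMap_eq fun p =>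
    (IsFractionRing.lift_algebraMap hinj p).symm
  have hX : algebraMap K[X] F X = x := by rw [hKX, aeval_X]
  exact exists_zpow_prod_isIntegral_of_adjoin_eq_top (hX.symm ▸ hxy) hP hPxy hcard u hu
    (hX.symm ▸ h1) (hX.symm ▸ h2)

theorem transcendental_algebraMap_C_X {k A K F : Type*} [Field k] [CommRing A] [IsDomain A]
    [Algebra k A] [Algebra A k[X][X]] [IsScalarTower k A k[X][X]] {f₀ : A}
    (hf₀ : Algebra.adjoin k {f₀} = ⊤) (hdeg : (algebraMap A k[X][X] f₀).natDegree ≠ 0)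
    [Field K] [Algebra A K] [IsFractionRing A K] [Field F] [Algebra k[X][X] F]
    [FaithfulSMul k[X][X] F] [Algebra A F] [IsScalarTower A k[X][X] F] [Algebra K F]
    [IsScalarTower A K F] : Transcendental K (algebraMap k[X][X] F (C X)) := by
  rw [transcendental_iff]
  intro r hr
  obtain ⟨b, hb, hbr⟩ := IsLocalization.integerNormalization_spec (nonZeroDivisors A) r
  set r' := IsLocalization.integerNormalization (nonZeroDivisors A) r
  have hsurj : Function.Surjective (aeval f₀ : k[X] →ₐ[k] A) := by
    rw [← AlgHom.range_eq_top, ← Algebra.adjoin_singleton_eq_range_aeval, hf₀]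
  obtain ⟨p, hp⟩ := map_surjective ((aeval f₀ : k[X] →ₐ[k] A) : k[X] →+* A) hsurj r'
  have h1 : aeval (C X : k[X][X]) r' = 0 := by
    apply FaithfulSMul.algebraMap_injective k[X][X] F
    rw [← aeval_algebraMap_apply, ← aeval_map_algebraMap K, hbr, map_zero,
      ← algebraMap_smul K, map_smul, hr, smul_zero]
  have hhom : ((aeval (C X : k[X][X]) : A[X] →ₐ[A] k[X][X]) : A[X] →+* k[X][X]).comp
      (mapRingHom ((aeval f₀ : k[X] →ₐ[k] A) : k[X] →+* A)) =
      (aevalAeval (algebraMap A k[X][X] f₀) (C X) : k[X][X] →ₐ[k] k[X][X]) := by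
    ext <;> simp [← IsScalarTower.algebraMap_apply]
  have hcomp : compRingHom (algebraMap A k[X][X] f₀) =
      ((aevalAeval (C X) (algebraMap A k[X][X] f₀) : k[X][X] →ₐ[k] k[X][X]) :
        k[X][X] →+* k[X][X]) := by
    ext <;> simp
  have h2 : aevalAeval (algebraMap A k[X][X] f₀) (C X : k[X][X]) p = 0 := by
    rw [← h1, ← hp]
    exact (congrArg (· p) hhom).symm
  have h3 : (Bivariate.swap p).comp (algebraMap A k[X][X] f₀) = 0 := by
    rw [← h2, ← Bivariate.aevalAeval_swap]
    exact congrArg (· (Bivariate.swap p)) hcomp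
  have h4 : p = 0 := by
    rcases comp_eq_zero_iff.1 h3 with h | ⟨-, h⟩
    · simpa using h
    · exact absurd (by rw [h, natDegree_C]) hdeg
  rw [← hp, h4, Polynomial.map_zero, Polynomial.map_zero, ← algebraMap_smul K, eq_comm,
    smul_eq_zero] at hbr
  exact hbr.resolve_left (IsFractionRing.to_map_ne_zero_of_mem_nonZeroDivisors hb)

theorem algebraMap_mem_adjoin_pair {k K F : Type*} [Field k] [Field K] [Field F]
    [Algebra k[X][X] F] [Algebra K F]
    (hk : ∀ a : k, algebraMap k[X][X] F (C (C a)) ∈ (algebraMap K F).range) (p : k[X][X]) :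
    algebraMap k[X][X] F p ∈
      Algebra.adjoin K {algebraMap k[X][X] F (C X), algebraMap k[X][X] F X} := by
  set B := Algebra.adjoin K {algebraMap k[X][X] F (C X), algebraMap k[X][X] F X}
  have hx : algebraMap k[X][X] F (C X) ∈ B := Algebra.subset_adjoin (by simp)
  have hy : algebraMap k[X][X] F X ∈ B := Algebra.subset_adjoin (by simp)
  have hC (q : k[X]) : algebraMap k[X][X] F (C q) ∈ B := by
    induction q using Polynomial.induction_on' with
    | add p q hp hq => rw [map_add, map_add]; exact B.add_mem hp hq
    | monomial n a =>
      obtain ⟨b, hb⟩ := hk a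
      rw [← C_mul_X_pow_eq_monomial, map_mul, map_mul, map_pow, map_pow, ← hb]
      exact B.mul_mem (B.algebraMap_mem b) (B.pow_mem hx n)
  induction p using Polynomial.induction_on' with
  | add p q hp hq => rw [map_add]; exact B.add_mem hp hq
  | monomial n a =>
    rw [← C_mul_X_pow_eq_monomial, map_mul, map_pow]
    exact B.mul_mem (hC a) (B.pow_mem hy n)

theorem adjoin_pair_eq_top {k K F : Type*} [Field k] [Field K] [Field F]
    [Algebra k[X][X] F] [IsFractionRing k[X][X] F] [Algebra K F]
    (hk : ∀ a : k, algebraMap k[X][X] F (C (C a)) ∈ (algebraMap K F).range) :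
    IntermediateField.adjoin K {algebraMap k[X][X] F (C X), algebraMap k[X][X] F X} = ⊤ := by
  refine eq_top_iff.2 fun z _ => ?_
  obtain ⟨a, b, -, rfl⟩ := IsFractionRing.div_surjective (A := k[X][X]) z
  exact div_mem (IntermediateField.algebra_adjoin_le_adjoin _ _ (algebraMap_mem_adjoin_pair hk a))
    (IntermediateField.algebra_adjoin_le_adjoin _ _ (algebraMap_mem_adjoin_pair hk b))

theorem exists_monic_eval₂_aeval_eq_zero {k K F : Type*} [Field k] [Field K] [Field F]
    [Algebra k[X][X] F] [Algebra K F] (φ : k →+* K)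
    (hφ : ∀ a : k, algebraMap k[X][X] F (C (C a)) = algebraMap K F (φ a)) {f : k[X][X]}
    (hf : f.Monic) (hdeg : f.natDegree ≠ 0) {t : K}
    (ht : algebraMap k[X][X] F f = algebraMap K F t) :
    ∃ P : K[X][X], P.Monic ∧ P.natDegree = f.natDegree ∧
      eval₂ ((aeval (algebraMap k[X][X] F (C X)) : K[X] →ₐ[K] F) : K[X] →+* F)
        (algebraMap k[X][X] F X) P = 0 := by
  have hd : (f.map (mapRingHom φ)).natDegree = f.natDegree := hf.natDegree_map _
  refine ⟨f.map (mapRingHom φ) - C (C t), ?_, ?_, ?_⟩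
  · refine (hf.map _).sub_of_left (degree_C_le.trans_lt ?_)
    rw [← natDegree_pos_iff_degree_pos, hd]
    omega
  · rw [natDegree_sub_C, hd]
  · have h : (eval₂RingHom ((aeval (algebraMap k[X][X] F (C X)) : K[X] →ₐ[K] F) : K[X] →+* F)
        (algebraMap k[X][X] F X)).comp (mapRingHom (mapRingHom φ)) = algebraMap k[X][X] F := by
      ext <;> simp [hφ]
    have h2 := congrArg (· f) h
    simp only [ht, RingHom.comp_apply, coe_mapRingHom, coe_eval₂RingHom] at h2
    rw [eval₂_sub, eval₂_C, RingHom.coe_coe, aeval_C, sub_eq_zero, h2]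

/-- If `f` is not composite and `f - c` is reducible, then `f - c` has two non-associated prime
factors. -/
theorem exists_prime_dvd_prime_dvd_not_dvd {k R : Type*} [Field k] [CommRing R] [IsDomain R]
    [UniqueFactorizationMonoid R] [Algebra k R]
    (hR : ∀ u : R, IsUnit u → u ∈ (algebraMap k R).range) {f : R}
    (hnc : ∀ (Q : k[X]) (g : R), f = aeval g Q → Q.natDegree ≤ 1) {c : k}
    (hf : f ≠ algebraMap k R c) (hu : ¬ IsUnit (f - algebraMap k R c))
    (hred : ¬ Irreducible (f - algebraMap k R c)) :
    ∃ s t : R, Prime s ∧ Prime t ∧ ¬ t ∣ s ∧ s ∣ f - algebraMap k R c ∧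
      t ∣ f - algebraMap k R c := by
  obtain ⟨s, hs, hsd⟩ := WfDvdMonoid.exists_irreducible_factor hu (sub_ne_zero.2 hf)
  obtain ⟨w, hw, hsw⟩ := (FiniteMultiplicity.of_not_isUnit hs.not_isUnit
    (sub_ne_zero.2 hf)).exists_eq_pow_mul_and_not_dvd
  set n := multiplicity s (f - algebraMap k R c)
  by_cases hwu : IsUnit w
  · obtain ⟨a, rfl⟩ := hR w hwu
    have ha : a ≠ 0 := by
      rintro rfl
      simp at hwu
    have hn := hnc (C a * X ^ n + C c) s (by
      rw [map_add, map_mul, map_pow, aeval_C, aeval_C, aeval_X, mul_comm, ← hw, sub_add_cancel])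
    rw [natDegree_add_C, natDegree_C_mul_X_pow _ _ ha] at hn
    have hn1 : n = 1 := le_antisymm hn (Nat.one_le_iff_ne_zero.2 (multiplicity_ne_zero.2 hsd))
    rw [hw, hn1, pow_one, irreducible_mul_isUnit hwu] at hred
    exact absurd hs hred
  · have hw0 : w ≠ 0 := by
      rintro rfl
      simp at hsw
    obtain ⟨t, ht, htw⟩ := WfDvdMonoid.exists_irreducible_factor hwu hw0
    refine ⟨s, t, hs.prime, ht.prime, fun h => hsw ?_, hsd, htw.trans (hw ▸ dvd_mul_left _ _)⟩
    exact (ht.dvd_symm hs h).trans htw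

theorem card_lt_natDegree_of_algebra {k A K F ι : Type*} [Field k] [CharZero k] [CommRing A]
    [IsDomain A] [Algebra k A] [Algebra A k[X][X]] [IsScalarTower k A k[X][X]]
    [Field K] [Algebra A K] [IsFractionRing A K] [Field F] [Algebra k[X][X] F]
    [IsFractionRing k[X][X] F] [Algebra A F] [IsScalarTower A k[X][X] F] [Algebra K F]
    [IsScalarTower A K F] [Fintype ι] {f₀ : A} (hf₀ : Algebra.adjoin k {f₀} = ⊤) {f : k[X][X]}
    (hff : algebraMap A k[X][X] f₀ = f) (hf : f.Monic) (hdeg : f.natDegree ≠ 0)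
    (hnc : ∀ (Q : k[X]) (g : k[X][X]), f = aeval g Q → Q.natDegree ≤ 1)
    {c : ι → k} (hc : Function.Injective c)
    (hred : ∀ i, ¬ Irreducible (f - algebraMap k k[X][X] (c i))) :
    Fintype.card ι < f.natDegree := by
  by_contra! hcard
  have hfC (a : k) : f ≠ algebraMap k k[X][X] a := by
    rintro rfl
    exact hdeg (natDegree_C _)
  have hR (u : k[X][X]) (hu : IsUnit u) : u ∈ (algebraMap k k[X][X]).range := by
    obtain ⟨p, hp, rfl⟩ := isUnit_iff.1 hu
    obtain ⟨a, ha, rfl⟩ := isUnit_iff.1 hp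
    exact ⟨a, rfl⟩
  have hunit (a : k) : ¬ IsUnit (f - algebraMap k k[X][X] a) := by
    intro h
    obtain ⟨b, hb⟩ := hR _ h
    exact hfC (b + a) (by rw [map_add, hb, sub_add_cancel])
  choose s t hs ht hts hsd htd using fun i =>
    exists_prime_dvd_prime_dvd_not_dvd hR hnc (hfC (c i)) (hunit (c i)) (hred i)
  choose g hg using hsd
  have hτ (a : k) : algebraMap k[X][X] F (C (C a)) =
      algebraMap K F (algebraMap A K (algebraMap k A a)) := by
    rw [← IsScalarTower.algebraMap_apply A K F, IsScalarTower.algebraMap_apply A k[X][X] F,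
      ← IsScalarTower.algebraMap_apply k A k[X][X]]
    rfl
  have hfF : algebraMap k[X][X] F f = algebraMap K F (algebraMap A K f₀) := by
    rw [← IsScalarTower.algebraMap_apply A K F, IsScalarTower.algebraMap_apply A k[X][X] F, hff]
  have hinj := FaithfulSMul.algebraMap_injective k[X][X] F
  have hmem (p : k[X][X]) := algebraMap_mem_adjoin_pair (K := K) (F := F)
    (fun a => ⟨_, (hτ a).symm⟩) p
  have : CharZero K := charZero_of_injective_ringHom (f := (algebraMap A K).comp (algebraMap k A))
    ((IsFractionRing.injective A K).comp (algebraMap k A).injective)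
  obtain ⟨P, hP, hPd, hP0⟩ := exists_monic_eval₂_aeval_eq_zero
    ((algebraMap A K).comp (algebraMap k A)) hτ hf hdeg hfF
  obtain ⟨a, ha, hint⟩ := exists_zpow_prod_isIntegral_of_transcendental
    (transcendental_algebraMap_C_X (A := A) (K := K) (F := F) hf₀ (by rwa [hff]))
    (adjoin_pair_eq_top fun a => ⟨_, (hτ a).symm⟩) hP hP0 (by rwa [hPd])
    (fun i => algebraMap k[X][X] F (s i)) (fun i => (map_ne_zero_iff _ hinj).2 (hs i).ne_zero)
    (fun i => hmem (s i)) (fun i => by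
      have hd : algebraMap k[X][X] F (s i) * algebraMap k[X][X] F (g i) =
          algebraMap K F (algebraMap A K (f₀ - algebraMap k A (c i))) := by
        rw [← map_mul, ← hg i, map_sub, map_sub, map_sub, hfF, ← hτ]
        rfl
      have h0 : algebraMap K F (algebraMap A K (f₀ - algebraMap k A (c i))) ≠ 0 := by
        rw [← hd, ← map_mul, ← hg i, map_ne_zero_iff _ hinj]
        exact sub_ne_zero.2 (hfC _)
      have : (algebraMap k[X][X] F (s i))⁻¹ = algebraMap k[X][X] F (g i) *
          algebraMap K F (algebraMap A K (f₀ - algebraMap k A (c i)))⁻¹ := by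
        rw [map_inv₀, ← div_eq_mul_inv, eq_div_iff h0, ← hd, inv_mul_cancel_left₀]
        exact (map_ne_zero_iff _ hinj).2 (hs i).ne_zero
      rw [this]
      exact mul_mem (hmem (g i)) (Subalgebra.algebraMap_mem _ _))
  obtain ⟨m, hm⟩ := hint.exists_multiple_integral_of_isLocalization (nonZeroDivisors A) _
  set w := ∏ i, algebraMap k[X][X] F (s i) ^ a i with hw
  have hw0 : w ≠ 0 := Finset.prod_ne_zero_iff.2 fun i _ =>
    zpow_ne_zero _ ((map_ne_zero_iff _ hinj).2 (hs i).ne_zero)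
  obtain ⟨p', hp'⟩ := IsIntegrallyClosed.isIntegral_iff.1 (hm.tower_top (A := k[X][X]))
  have hp'' : IsIntegral A p' := by
    rwa [← isIntegral_algebraMap_iff hinj, hp']
  obtain ⟨p, rfl⟩ := exists_eq_aeval_of_isIntegral hf₀ hff hf hdeg hnc hp''
  obtain ⟨q, hq⟩ : ∃ q : k[X], aeval f₀ q = m := by
    have : (m : A) ∈ Algebra.adjoin k {f₀} := hf₀ ▸ Algebra.mem_top
    rwa [Algebra.adjoin_singleton_eq_range_aeval] at this
  have hm0 : algebraMap A F m ≠ 0 := by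
    rw [IsScalarTower.algebraMap_apply A K F, _root_.map_ne_zero]
    exact IsFractionRing.to_map_ne_zero_of_mem_nonZeroDivisors m.2
  have hqm : aeval f q = algebraMap A k[X][X] m := by
    rw [← hq, ← aeval_algebraMap_apply, hff]
  have hqf : algebraMap k[X][X] F (aeval f q) = algebraMap A F m := by
    rw [hqm, ← IsScalarTower.algebraMap_apply]
  have hq0 : q ≠ 0 := by
    rintro rfl
    simp [← hqf] at hm0
  change _ = (m : A) • w at hp'
  rw [Algebra.smul_def, ← hqf] at hp'
  have hp0 : p ≠ 0 := by
    rintro rfl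
    rw [map_zero, map_zero, eq_comm, hqf] at hp'
    exact mul_ne_zero hm0 hw0 hp'
  have hsplit : w * algebraMap k[X][X] F (∏ i, s i ^ (-a i).toNat) =
      algebraMap k[X][X] F (∏ i, s i ^ (a i).toNat) := by
    rw [hw, map_prod, map_prod, ← Finset.prod_mul_distrib]
    refine Finset.prod_congr rfl fun i _ => ?_
    rw [map_pow, map_pow, ← zpow_natCast, ← zpow_natCast,
      ← zpow_add₀ ((map_ne_zero_iff _ hinj).2 (hs i).ne_zero)]
    congr 1
    omega
  have hab := eq_of_aeval_mul_prod_pow_eq hc (fun i => hfC (c i)) hs ht hts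
    (fun i => ⟨_, hg i⟩) htd hp0 hq0 (a := fun i => (a i).toNat) (b := fun i => (-a i).toNat) (by
      apply hinj
      rw [map_mul, map_mul, hp', ← hsplit, mul_assoc])
  exact ha (funext fun i => by have := congrFun hab i; simp only [Pi.zero_apply] at *; omega)

theorem card_lt_natDegree_of_adjoin_eq_top {k A F ι : Type*} [Field k] [CharZero k] [CommRing A]
    [IsDomain A] [Algebra k A] [Algebra A k[X][X]] [IsScalarTower k A k[X][X]]
    [FaithfulSMul A k[X][X]] [Field F] [Algebra k[X][X] F] [IsFractionRing k[X][X] F]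
    [Fintype ι] {f₀ : A} (hf₀ : Algebra.adjoin k {f₀} = ⊤) {f : k[X][X]}
    (hff : algebraMap A k[X][X] f₀ = f) (hf : f.Monic) (hdeg : f.natDegree ≠ 0)
    (hnc : ∀ (Q : k[X]) (g : k[X][X]), f = aeval g Q → Q.natDegree ≤ 1)
    {c : ι → k} (hc : Function.Injective c)
    (hred : ∀ i, ¬ Irreducible (f - algebraMap k k[X][X] (c i))) :
    Fintype.card ι < f.natDegree := by
  let : Algebra A F := ((algebraMap k[X][X] F).comp (algebraMap A k[X][X])).toAlgebra
  have : IsScalarTower A k[X][X] F := IsScalarTower.of_algebraMap_eq fun _ => rfl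
  have hinj : Function.Injective (algebraMap A F) :=
    (IsFractionRing.injective k[X][X] F).comp (FaithfulSMul.algebraMap_injective A k[X][X])
  let : Algebra (FractionRing A) F :=
    (IsFractionRing.lift (A := A) (K := FractionRing A) hinj).toAlgebra
  have : IsScalarTower A (FractionRing A) F := IsScalarTower.of_algebraMap_eq fun p =>
    (IsFractionRing.lift_algebraMap hinj p).symm
  exact card_lt_natDegree_of_algebra (K := FractionRing A) (F := F) hf₀ hff hf hdeg hnc hc hred

/-- A noncomposite monic polynomial `f` in two variables has fewer than `f.natDegree` constants `c`
for which `f - c` is reducible. -/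
theorem card_lt_natDegree {k : Type*} [Field k] [CharZero k] {f : k[X][X]} (hf : f.Monic)
    (hdeg : f.natDegree ≠ 0)
    (hnc : ∀ (Q : k[X]) (g : k[X][X]), f = aeval g Q → Q.natDegree ≤ 1) (S : Finset k)
    (hred : ∀ c ∈ S, ¬ Irreducible (f - C (C c))) : S.card < f.natDegree := by
  have hA : Algebra.adjoin k
      {(⟨f, Algebra.self_mem_adjoin_singleton k f⟩ : Algebra.adjoin k {f})} = ⊤ := by
    convert Algebra.adjoin_adjoin_coe_preimage (R := k) (s := {f})
    ext
    simp [Subtype.ext_iff]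
  rw [← Fintype.card_coe]
  exact card_lt_natDegree_of_adjoin_eq_top (A := Algebra.adjoin k {f})
    (F := FractionRing k[X][X]) hA rfl hf hdeg hnc
    Subtype.val_injective fun i => hred _ i.2

theorem MvPolynomial.IsHomogeneous.eval_mul_left {k σ : Type*} [CommSemiring k] [Fintype σ]
    {p : MvPolynomial σ k} {n : ℕ} (hp : p.IsHomogeneous n) (r : k) (α : σ → k) :
    MvPolynomial.eval (fun i => r * α i) p = r ^ n * MvPolynomial.eval α p := by
  rw [MvPolynomial.eval_eq', MvPolynomial.eval_eq', Finset.mul_sum]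
  refine Finset.sum_congr rfl fun d hd => ?_
  have hd' : ∑ i, d i = n := by
    rw [← Finsupp.degree_eq_sum, Finsupp.degree_eq_weight_one]
    exact hp (MvPolynomial.mem_support_iff.1 hd)
  simp_rw [mul_pow, Finset.prod_mul_distrib, Finset.prod_pow_eq_pow_sum, hd']
  ring

theorem exists_eval_homogeneousComponent_eq_one {k σ : Type*} [Field k] [IsAlgClosed k] [Fintype σ]
    {f : MvPolynomial σ k} (hf : f.totalDegree ≠ 0) :
    ∃ α : σ → k, MvPolynomial.eval α (MvPolynomial.homogeneousComponent f.totalDegree f) = 1 := by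
  have : Infinite k := IsAlgClosed.instInfinite
  obtain ⟨d, hd, hdf⟩ := Finset.exists_mem_eq_sup f.support (by
    rw [MvPolynomial.support_nonempty]
    rintro rfl
    simp at hf) (fun s => s.sum fun _ e => e)
  have h0 : MvPolynomial.homogeneousComponent f.totalDegree f ≠ 0 := by
    intro h
    have := congrArg (MvPolynomial.coeff d) h
    rw [MvPolynomial.coeff_homogeneousComponent, if_pos (by rw [MvPolynomial.totalDegree, hdf]; rfl),
      MvPolynomial.coeff_zero] at this
    exact MvPolynomial.mem_support_iff.1 hd this
  obtain ⟨α, hα⟩ : ∃ α, MvPolynomial.eval α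
      (MvPolynomial.homogeneousComponent f.totalDegree f) ≠ 0 := by
    by_contra! h
    exact h0 (MvPolynomial.funext fun α => by rw [h, map_zero])
  obtain ⟨r, hr⟩ := IsAlgClosed.exists_pow_nat_eq (MvPolynomial.eval α
      (MvPolynomial.homogeneousComponent f.totalDegree f))⁻¹ (Nat.pos_of_ne_zero hf)
  refine ⟨fun i => r * α i, ?_⟩
  rw [(MvPolynomial.homogeneousComponent_isHomogeneous _ _).eval_mul_left, hr, inv_mul_cancel₀ hα]

theorem natDegree_aeval_le {k S σ : Type*} [CommSemiring k] [CommSemiring S] [Algebra k S]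
    {p : MvPolynomial σ k} {m : ℕ} (hp : p.totalDegree ≤ m) {l : σ → S[X]}
    (hl : ∀ i, (l i).natDegree ≤ 1) : (MvPolynomial.aeval l p).natDegree ≤ m := by
  have h := MvPolynomial.aeval_natDegree_le (MvPolynomial.map (algebraMap k S) p)
    ((Finset.sup_mono (MvPolynomial.support_map_subset _ _)).trans hp) l hl
  rwa [MvPolynomial.aeval_map_algebraMap, mul_one] at h

theorem coeff_aeval_eq_eval_homogeneousComponent {k S σ : Type*} [CommSemiring k] [CommSemiring S]
    [Algebra k S] [Fintype σ] {p : MvPolynomial σ k} {m : ℕ} (hp : p.totalDegree ≤ m)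
    {l : σ → S[X]} (hl : ∀ i, (l i).natDegree ≤ 1) {α : σ → k}
    (hα : ∀ i, (l i).coeff 1 = algebraMap k S (α i)) :
    (MvPolynomial.aeval l p).coeff m =
      algebraMap k S (MvPolynomial.eval α (MvPolynomial.homogeneousComponent m p)) := by
  have hprod (d : σ →₀ ℕ) (s : Finset σ) : (∏ i ∈ s, l i ^ d i).natDegree ≤ ∑ i ∈ s, d i ∧
      (∏ i ∈ s, l i ^ d i).coeff (∑ i ∈ s, d i) = ∏ i ∈ s, algebraMap k S (α i) ^ d i := by
    classical
    have hpow (i : σ) : (l i ^ d i).natDegree ≤ d i := by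
      simpa using natDegree_pow_le_of_le (d i) (hl i)
    induction s using Finset.induction_on with
    | empty => simp
    | insert i s hi ih =>
      rw [Finset.prod_insert hi, Finset.sum_insert hi, Finset.prod_insert hi]
      refine ⟨natDegree_mul_le_of_le (hpow i) ih.1, ?_⟩
      rw [coeff_mul_add_eq_of_natDegree_le (hpow i) ih.1, ih.2, ← hα]
      congr 1
      simpa using coeff_pow_of_natDegree_le (m := d i) (hl i)
  rw [MvPolynomial.homogeneousComponent_apply, map_sum, map_sum, MvPolynomial.aeval_def,
    MvPolynomial.eval₂_eq', finsetSum_coeff, Finset.sum_filter]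
  refine Finset.sum_congr rfl fun d hd => ?_
  rw [Polynomial.algebraMap_apply, coeff_C_mul]
  split_ifs with h
  · rw [Finsupp.degree_eq_sum] at h
    rw [← h, (hprod d _).2, MvPolynomial.eval_monomial, Finsupp.prod_fintype _ _ (by simp)]
    simp
  · rw [coeff_eq_zero_of_natDegree_lt, mul_zero]
    refine (hprod d _).1.trans_lt ?_
    rw [← Finsupp.degree_eq_sum]
    refine lt_of_le_of_ne (le_trans ?_ hp) h
    exact MvPolynomial.le_totalDegree hd

/-- After a linear change of variables, a nonconstant polynomial in two variables is monic in the
second one, of degree its total degree. -/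
theorem exists_algEquiv_monic {k : Type*} [Field k] [IsAlgClosed k]
    {f : MvPolynomial (Fin 2) k} (hf : f.totalDegree ≠ 0) :
    ∃ e : MvPolynomial (Fin 2) k ≃ₐ[k] k[X][X], (e f).Monic ∧ (e f).natDegree = f.totalDegree := by
  obtain ⟨α, hα⟩ := exists_eval_homogeneousComponent_eq_one hf
  obtain ⟨β, hβ⟩ : ∃ β : Fin 2 → k, α 0 * β 1 - α 1 * β 0 = 1 := by
    by_cases h0 : α 0 = 0
    · have h1 : α 1 ≠ 0 := by
        intro h1
        have : (fun i => 0 * α i) = α := by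
          ext i
          fin_cases i <;> simp [h0, h1]
        rw [← this, (MvPolynomial.homogeneousComponent_isHomogeneous _ _).eval_mul_left,
          zero_pow hf, zero_mul] at hα
        exact zero_ne_one hα
      exact ⟨![-(α 1)⁻¹, 0], by simp [h1]⟩
    · exact ⟨![0, (α 0)⁻¹], by simp [h0]⟩
  let l : Fin 2 → k[X][X] := fun i => C (C (α i)) * X + C (C (β i) * X)
  have hC (a : k) : algebraMap k k[X][X] a = C (C a) := rfl
  have hβ' : (C (C (α 0)) * C (C (β 1)) - C (C (α 1)) * C (C (β 0)) : k[X][X]) = 1 := by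
    rw [← C_mul, ← C_mul, ← C_mul, ← C_mul, ← C_sub, ← C_sub, hβ, C_1, C_1]
  have hβ'' : (MvPolynomial.C (α 0) * MvPolynomial.C (β 1) -
      MvPolynomial.C (α 1) * MvPolynomial.C (β 0) : MvPolynomial (Fin 2) k) = 1 := by
    rw [← MvPolynomial.C_mul, ← MvPolynomial.C_mul, ← MvPolynomial.C_sub, hβ, MvPolynomial.C_1]
  let e : MvPolynomial (Fin 2) k ≃ₐ[k] k[X][X] := .ofAlgHom (MvPolynomial.aeval l)
    (aevalAeval
      (MvPolynomial.C (α 0) * MvPolynomial.X 1 - MvPolynomial.C (α 1) * MvPolynomial.X 0)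
      (MvPolynomial.C (β 1) * MvPolynomial.X 0 - MvPolynomial.C (β 0) * MvPolynomial.X 1))
    (algHom_ext' (algHom_ext (by
      change _ = (C X : k[X][X])
      simp only [l, AlgHom.comp_apply, CAlgHom_apply, aevalAeval_X, map_sub, map_mul,
        MvPolynomial.aeval_X, MvPolynomial.aeval_C, hC]
      linear_combination C X * hβ')) (by
      simp only [l, AlgHom.comp_apply, aevalAeval_Y, map_sub, map_mul,
        MvPolynomial.aeval_X, MvPolynomial.aeval_C, hC, AlgHom.id_apply]
      linear_combination X * hβ'))
    (MvPolynomial.algHom_ext fun i => by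
      simp only [l, AlgHom.comp_apply, map_add, map_mul, MvPolynomial.aeval_X, aevalAeval_Y,
        aevalAeval_C, aeval_C, aeval_X, MvPolynomial.algebraMap_eq, AlgHom.id_apply]
      revert i
      refine Fin.forall_fin_two.2 ⟨?_, ?_⟩
      · linear_combination MvPolynomial.X 0 * hβ''
      · linear_combination MvPolynomial.X 1 * hβ'')
  have hl (i) : (l i).natDegree ≤ 1 := by
    simp only [l]
    compute_degree
  have hcoeff : (e f).coeff f.totalDegree = 1 := by
    refine (coeff_aeval_eq_eval_homogeneousComponent le_rfl hl (α := α) fun i => ?_).trans ?_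
    · simp [l]
    · rw [hα, map_one]
  have hle : (e f).natDegree ≤ f.totalDegree := natDegree_aeval_le le_rfl hl
  exact ⟨e, monic_of_natDegree_le_of_coeff_eq_one _ hle hcoeff,
    le_antisymm hle (le_natDegree_of_ne_zero (by simp [hcoeff]))⟩

theorem not_irreducible_of_totalDegree {k σ : Type*} [Field k] {p u v : MvPolynomial σ k}
    (hu : 1 ≤ u.totalDegree) (hv : 1 ≤ v.totalDegree) (h : p = u * v) : ¬ Irreducible p := by
  intro hp
  have hunit {w : MvPolynomial σ k} (hw : 1 ≤ w.totalDegree) : ¬ IsUnit w := fun h => by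
    rw [MvPolynomial.isUnit_iff_totalDegree_of_isReduced] at h
    omega
  exact (hp.isUnit_or_isUnit h).elim (hunit hu) (hunit hv)

end

/-- Y. Stein's theorem: for a non-constant, non-composite `f ∈ ℂ[x,y]` of total degree
`k`, the set `σ(f)` of `λ ∈ ℂ` for which `f − λ` is reducible is finite of size `< k`. -/
theorem stein_reducibility (k : ℕ) (f : MvPolynomial (Fin 2) ℂ)
    (hdeg : f.totalDegree = k) (hk : 1 ≤ k) (hnc : ¬ IsCompositeC f) :
    ({lam : ℂ | ∃ u v : MvPolynomial (Fin 2) ℂ,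
        1 ≤ u.totalDegree ∧ 1 ≤ v.totalDegree ∧ f - MvPolynomial.C lam = u * v}).Finite ∧
    ({lam : ℂ | ∃ u v : MvPolynomial (Fin 2) ℂ,
        1 ≤ u.totalDegree ∧ 1 ≤ v.totalDegree ∧ f - MvPolynomial.C lam = u * v}).ncard < k := by
  have hd : f.totalDegree ≠ 0 := by omega
  obtain ⟨e, hm, he⟩ := exists_algEquiv_monic hd
  have hcomp (Q : Polynomial ℂ) (g : Polynomial (Polynomial ℂ)) (h : e f = Polynomial.aeval g Q) :
      Q.natDegree ≤ 1 := by
    by_contra! hQ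
    refine hnc ⟨Q, e.symm g, hQ, fun x y => ?_⟩
    rw [← e.symm_apply_apply f, h, ← AlgEquiv.coe_toAlgHom, ← Polynomial.aeval_algHom_apply,
      ← MvPolynomial.coe_aeval_eq_eval, ← Polynomial.coe_aeval_eq_eval]
    exact (Polynomial.aeval_algHom_apply (MvPolynomial.aeval ![x, y]) _ Q).symm
  set σ := {lam : ℂ | ∃ u v : MvPolynomial (Fin 2) ℂ,
    1 ≤ u.totalDegree ∧ 1 ≤ v.totalDegree ∧ f - MvPolynomial.C lam = u * v}
  have hcard (S : Finset ℂ) (hS : (S : Set ℂ) ⊆ σ) : S.card < k := by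
    rw [← hdeg, ← he]
    refine card_lt_natDegree hm (by rwa [he]) hcomp S fun c hc => ?_
    obtain ⟨u, v, hu, hv, h⟩ := hS hc
    have hec : e f - Polynomial.C (Polynomial.C c) = e (f - MvPolynomial.C c) := by
      rw [map_sub]
      exact congrArg _ (e.commutes c).symm
    rw [hec, MulEquiv.irreducible_iff]
    exact not_irreducible_of_totalDegree hu hv h
  have hfin : σ.Finite := by
    by_contra h
    obtain ⟨S, hS, hSk⟩ := Set.Infinite.exists_subset_card_eq h k
    exact (hcard S hS).ne hSk
  refine ⟨hfin, ?_⟩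
  rw [Set.ncard_eq_toFinset_card σ hfin]
  exact hcard _ (by simp)
end
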